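/- Sharp weighted Sobolev inequality: Let n ≥ 2, 1 ≤ p < n, and define q by 1/p − 1/q = 1/n. Then there is a constant c = c(n,p) such that for every weight w ∈ A_{p,q} (with the A_{1,q} condition when p = 1) and every Lipschitz function f on ℝⁿ with compact support, (∫_{ℝⁿ} (|f(x)| w(x))^q dx)^{1/q} ≤ c [w]_{A_{p,q}}^{1/n′} (∫_{ℝⁿ} (|∇f(x)| w(x))^p dx)^{1/p}, where 1/n′ = 1 − 1/n and ∇f denotes the (almost everywhere defined) gradient of f. -/

import Mathlib

open MeasureTheory ENNReal Set

noncomputable section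

/-- Euclidean space `ℝⁿ`. -/
abbrev Euc (n : ℕ) := EuclideanSpace ℝ (Fin n)

variable {n : ℕ}

/-- The axis-parallel closed cube with lower corner `a` and side length `h`. -/
def Cube (a : Euc n) (h : ℝ) : Set (Euc n) :=
  {x | ∀ i, a i ≤ x i ∧ x i ≤ a i + h}

/-- The weighted measure `u(E) = ∫_E u dx` of a set. -/
def wMeas (u : Euc n → ℝ) (E : Set (Euc n)) : ℝ≥0∞ :=
  ∫⁻ x in E, ENNReal.ofReal (u x)

/-- The dual exponent `p' = p/(p-1)`. -/
def dualExp (p : ℝ) : ℝ := p / (p - 1)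

/-- The `A_{p,q}` constant of a weight `w` (with the `A_{1,q}` convention when `p = 1`). -/
def Apq (p q : ℝ) (w : Euc n → ℝ) : ℝ≥0∞ :=
  ⨆ (a : Euc n) (h : ℝ) (_ : 0 < h),
    ((volume (Cube a h))⁻¹ * ∫⁻ x in Cube a h, ENNReal.ofReal (w x) ^ q) *
      (if p = 1 then
        (essSup (fun x => (ENNReal.ofReal (w x))⁻¹) (volume.restrict (Cube a h))) ^ q
      else
        ((volume (Cube a h))⁻¹ * ∫⁻ x in Cube a h,
            ENNReal.ofReal (w x) ^ (-(dualExp p))) ^ (q / dualExp p))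

/-- The weighted Lebesgue norm `‖w f‖_{L^p(ℝⁿ)}`. -/
def wLp (w f : Euc n → ℝ) (p : ℝ) : ℝ≥0∞ :=
  (∫⁻ x, (ENNReal.ofReal (w x) * ENNReal.ofReal |f x|) ^ p) ^ (1 / p)

/-- The weighted Lebesgue norm `‖w g‖_{L^q(ℝⁿ)}` of an `ℝ≥0∞`-valued function. -/
def wLpE (w : Euc n → ℝ) (g : Euc n → ℝ≥0∞) (q : ℝ) : ℝ≥0∞ :=
  (∫⁻ x, (ENNReal.ofReal (w x) * g x) ^ q) ^ (1 / q)

/-- The weak norm `‖g‖_{L^{q,∞}(u)} = sup_{λ>0} λ u({|g|>λ})^{1/q}`. -/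
def weakLp (u : Euc n → ℝ) (g : Euc n → ℝ) (q : ℝ) : ℝ≥0∞ :=
  ⨆ (t : ℝ) (_ : 0 < t), ENNReal.ofReal t * wMeas u {x | t < |g x|} ^ (1 / q)

/-- The weak norm of an `ℝ≥0∞`-valued function. -/
def weakLpE (u : Euc n → ℝ) (g : Euc n → ℝ≥0∞) (q : ℝ) : ℝ≥0∞ :=
  ⨆ (t : ℝ) (_ : 0 < t), ENNReal.ofReal t * wMeas u {x | ENNReal.ofReal t < g x} ^ (1 / q)

/-- The fractional integral (Riesz potential) `I_α f(x) = ∫ |f(y)| |x-y|^{α-n} dy`. -/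
def riesz (α : ℝ) (f : Euc n → ℝ) (x : Euc n) : ℝ≥0∞ :=
  ∫⁻ y, ENNReal.ofReal |f y| * ENNReal.ofReal (‖x - y‖ ^ (α - (n : ℝ)))

/-- The fractional maximal operator `M_α f(x) = sup_{Q ∋ x} |Q|^{α/n-1} ∫_Q |f|`. -/
def fracMax (α : ℝ) (f : Euc n → ℝ) (x : Euc n) : ℝ≥0∞ :=
  ⨆ (a : Euc n) (h : ℝ) (_ : 0 < h) (_ : x ∈ Cube a h),
    volume (Cube a h) ^ (α / (n : ℝ) - 1) * ∫⁻ y in Cube a h, ENNReal.ofReal |f y|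


section Part1
open MeasureTheory ENNReal Set

theorem two_zpow_ne_zero (k : ℤ) : (2:ℝ≥0∞)^k ≠ 0 := (ENNReal.zpow_pos (by norm_num) (by norm_num) k).ne'
theorem two_zpow_ne_top (k : ℤ) : (2:ℝ≥0∞)^k ≠ ⊤ := (ENNReal.zpow_lt_top (by norm_num) (by norm_num) k).ne

theorem dyadic_upper (F : ℝ≥0∞) {s : ℝ} (hs : 0 < s) :
    F ^ s ≤ ∑' k : ℤ, ((2:ℝ≥0∞)^(k+1))^s * (if (2:ℝ≥0∞)^k < F then 1 else 0) := by
  rcases eq_or_ne F 0 with rfl | h0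
  · simp [ENNReal.zero_rpow_of_pos hs]
  rcases eq_or_ne F ⊤ with rfl | ht
  · have : (∑' _ : ℕ, (1:ℝ≥0∞)) ≤ ∑' k : ℤ, ((2:ℝ≥0∞)^(k+1))^s * (if (2:ℝ≥0∞)^k < ⊤ then 1 else 0) := by
      refine le_trans ?_ (ENNReal.tsum_comp_le_tsum_of_injective (f := fun n : ℕ => (n:ℤ))
        (fun a b h => by simpa using h) _)
      refine ENNReal.tsum_le_tsum fun k => ?_
      rw [if_pos (two_zpow_ne_top _).lt_top, mul_one]
      apply ENNReal.one_le_rpow _ hs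
      have : (1:ℝ≥0∞) = (2:ℝ≥0∞)^(0:ℤ) := by simp
      rw [this]
      exact ENNReal.zpow_le_of_le (by norm_num) (by omega)
    rw [ENNReal.tsum_const_eq_top_of_ne_zero one_ne_zero] at this
    rw [top_le_iff.1 this]; exact le_top
  obtain ⟨k, hk, hk'⟩ := ENNReal.exists_mem_Ioc_zpow h0 ht (y := 2) (by norm_num) (by norm_num)
  refine le_trans ?_ (ENNReal.le_tsum k)
  rw [if_pos hk, mul_one]
  exact ENNReal.rpow_le_rpow hk' hs.le

theorem dyadic_lower {a : ℝ} (ha : 0 < a) : ∃ C : ℝ≥0∞, C ≠ 0 ∧ C ≠ ⊤ ∧ ∀ t : ℝ≥0∞,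
    ∑' k : ℤ, ((2:ℝ≥0∞)^k)^a * (if (2:ℝ≥0∞)^k < t then 1 else 0) ≤ C * t^a := by
  have h2 : (2:ℝ≥0∞)^(-a) < 1 := ENNReal.rpow_lt_one_of_one_lt_of_neg (by norm_num) (by linarith)
  refine ⟨(1 - (2:ℝ≥0∞)^(-a))⁻¹, ?_, ?_, ?_⟩
  · simp
  · simpa [tsub_eq_zero_iff_le] using h2
  intro t
  rcases eq_or_ne t 0 with rfl | h0
  · simp
  rcases eq_or_ne t ⊤ with rfl | ht
  · rw [ENNReal.top_rpow_of_pos ha, ENNReal.mul_top]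
    · exact le_top
    · simp
  obtain ⟨k, hk, hk'⟩ := ENNReal.exists_mem_Ioc_zpow h0 ht (y := 2) (by norm_num) (by norm_num)
  have hinj : Function.Injective (fun j : ℕ => k - (j:ℤ)) := fun a b h => by simpa using h
  rw [← hinj.tsum_eq]
  · calc _ ≤ ∑' j : ℕ, t^a * ((2:ℝ≥0∞)^(-a))^j := by
          refine ENNReal.tsum_le_tsum fun j => ?_
          have e1 : ((2:ℝ≥0∞)^(k - (j:ℤ)))^a = ((2:ℝ≥0∞)^k)^a * ((2:ℝ≥0∞)^(-a))^j := by
            rw [← ENNReal.rpow_intCast, ← ENNReal.rpow_intCast, ← ENNReal.rpow_natCast,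
              ← ENNReal.rpow_mul, ← ENNReal.rpow_mul, ← ENNReal.rpow_mul,
              ← ENNReal.rpow_add _ _ (by norm_num) (by norm_num)]
            congr 1; push_cast; ring
          rw [e1]
          calc _ ≤ ((2:ℝ≥0∞)^k)^a * ((2:ℝ≥0∞)^(-a))^j * 1 := by
                gcongr; split_ifs <;> simp
            _ ≤ _ := by
                rw [mul_one]; gcongr
      _ = _ := by rw [ENNReal.tsum_mul_left, ENNReal.tsum_geometric, mul_comm]
  · intro i hi
    simp only [Function.mem_support, ne_eq, mul_eq_zero, not_or] at hi
    have h3 : (2:ℝ≥0∞)^i < t := by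
      by_contra h; simp [h] at hi
    have h4 : i < k + 1 := by
      by_contra h
      have := ENNReal.zpow_le_of_le (x := 2) (by norm_num) (not_lt.1 h)
      exact absurd (h3.trans_le hk') (not_lt.2 this)
    exact ⟨(k - i).toNat, by simp; omega⟩

variable {E : Type*} [NormedAddCommGroup E] [NormedSpace ℝ E] [FiniteDimensional ℝ E]
  [MeasurableSpace E] [BorelSpace E]

def cMax (μ : Measure E) (h : E → ℝ≥0∞) (x : E) : ℝ≥0∞ :=
  ⨆ k : ℤ, (∫⁻ y in Metric.closedBall x ((2:ℝ)^k), h y ∂μ) / μ (Metric.closedBall x ((2:ℝ)^k))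

theorem measurable_ballInt (μ : Measure E) [SFinite μ] {h : E → ℝ≥0∞} (hh : Measurable h) (r : ℝ) :
    Measurable (fun x => ∫⁻ y in Metric.closedBall x r, h y ∂μ) := by
  have hS : MeasurableSet {z : E × E | dist z.2 z.1 ≤ r} :=
    (isClosed_le (by fun_prop) (by fun_prop)).measurableSet
  have : (fun x => ∫⁻ y in Metric.closedBall x r, h y ∂μ) = fun x => ∫⁻ y,
      ({z : E × E | dist z.2 z.1 ≤ r}.indicator (fun z => h z.2)) (x, y) ∂μ := by
    funext x
    rw [← lintegral_indicator Metric.isClosed_closedBall.measurableSet]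
    rfl
  rw [this]
  exact ((hh.comp measurable_snd).indicator hS).lintegral_prod_right'

theorem measurable_ballMeas (μ : Measure E) [SFinite μ] (r : ℝ) :
    Measurable (fun x => μ (Metric.closedBall x r)) := by
  simpa using measurable_ballInt μ (measurable_const (a := (1:ℝ≥0∞))) r

theorem measurable_cMax (μ : Measure E) [SFinite μ] {h : E → ℝ≥0∞} (hh : Measurable h) :
    Measurable (cMax μ h) :=
  Measurable.iSup fun k => (measurable_ballInt μ hh _).div (measurable_ballMeas μ _)

theorem cMax_weak (E : Type*) [NormedAddCommGroup E] [NormedSpace ℝ E] [FiniteDimensional ℝ E]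
  [MeasurableSpace E] [BorelSpace E] : ∃ N : ℕ, ∀ (μ : Measure E) (h : E → ℝ≥0∞) (l : ℝ≥0∞),
    l * μ {x | l < cMax μ h x} ≤ N * ∫⁻ y, h y ∂μ := by
  obtain ⟨N, τ, hτ, hN⟩ := HasBesicovitchCovering.no_satelliteConfig (α := E)
  refine ⟨N, fun μ h l => ?_⟩
  let A : ℕ → Set E := fun K => {x | ∃ k : ℤ, k ≤ K ∧ l * μ (Metric.closedBall x ((2:ℝ)^k)) ≤
     ∫⁻ y in Metric.closedBall x ((2:ℝ)^k), h y ∂μ}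
  have hA : {x | l < cMax μ h x} ⊆ ⋃ K, A K := by
    intro x hx
    obtain ⟨k, hk⟩ := lt_iSup_iff.1 (show l < ⨆ k : ℤ, _ from hx)
    exact mem_iUnion.2 ⟨k.toNat, k, by omega, (ENNReal.mul_lt_of_lt_div hk).le⟩
  have hmono : Monotone A := by
    rintro a b hab x ⟨k, hk, hk'⟩
    exact ⟨k, by omega, hk'⟩
  have key : ∀ K, l * μ (A K) ≤ N * ∫⁻ y, h y ∂μ := by
    intro K
    choose k hk hk' using fun x : A K => x.2
    let P : Besicovitch.BallPackage (A K) E :=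
      { c := fun x => x
        r := fun x => (2:ℝ)^(k x)
        rpos := fun x => by positivity
        r_bound := (2:ℝ)^(K:ℤ)
        r_le := fun x => zpow_le_zpow_right₀ (by norm_num) (hk x) }
    obtain ⟨s, hs, hcov⟩ := Besicovitch.exist_disjoint_covering_families hτ hN P
    have hc : ∀ i, (s i).Countable := fun i =>
      (hs i).countable_of_nonempty_interior fun j _ => by
        refine ⟨P.c j, ?_⟩
        exact Metric.ball_subset_interior_closedBall (Metric.mem_ball_self (P.rpos j))
    have hcov2 : A K ⊆ ⋃ i, ⋃ j ∈ s i, Metric.closedBall (P.c j) (P.r j) := by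
      intro x hx
      have := hcov ⟨⟨x, hx⟩, rfl⟩
      simp only [mem_iUnion] at this ⊢
      obtain ⟨i, j, hj, h3⟩ := this
      exact ⟨i, j, hj, Metric.ball_subset_closedBall h3⟩
    calc l * μ (A K) ≤ l * ∑ i, ∑' j : s i, μ (Metric.closedBall (P.c j) (P.r j)) := by
          gcongr
          refine (measure_mono hcov2).trans ((measure_iUnion_fintype_le _ _).trans ?_)
          exact Finset.sum_le_sum fun i _ => measure_biUnion_le μ (hc i) _
      _ = ∑ i, ∑' j : s i, l * μ (Metric.closedBall (P.c j) (P.r j)) := by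
          rw [Finset.mul_sum]; simp_rw [ENNReal.tsum_mul_left]
      _ ≤ ∑ i, ∑' j : s i, ∫⁻ y in Metric.closedBall (P.c j) (P.r j), h y ∂μ := by
          gcongr with i _ j
          exact hk' j
      _ = ∑ i, ∫⁻ y in ⋃ j ∈ s i, Metric.closedBall (P.c j) (P.r j), h y ∂μ := by
          refine Finset.sum_congr rfl fun i _ => ?_
          rw [lintegral_biUnion (hc i) (fun j _ => Metric.isClosed_closedBall.measurableSet) (hs i)]
      _ ≤ ∑ i : Fin N, ∫⁻ y, h y ∂μ := by
          gcongr; exact Measure.restrict_le_self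
      _ = _ := by simp
  calc l * μ {x | l < cMax μ h x} ≤ l * μ (⋃ K, A K) := by gcongr
    _ = ⨆ K, l * μ (A K) := by rw [hmono.measure_iUnion, ENNReal.mul_iSup]
    _ ≤ _ := iSup_le key

theorem cMax_strong (E : Type*) [NormedAddCommGroup E] [NormedSpace ℝ E] [FiniteDimensional ℝ E]
  [MeasurableSpace E] [BorelSpace E] {s : ℝ} (hs : 1 < s) : ∃ C : ℝ≥0∞, C ≠ ⊤ ∧
    ∀ (μ : Measure E) [SFinite μ] (h : E → ℝ≥0∞), Measurable h →
    ∫⁻ x, cMax μ h x ^ s ∂μ ≤ C * ∫⁻ x, h x ^ s ∂μ := by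
  obtain ⟨N, hN⟩ := cMax_weak E
  obtain ⟨C, hC0, hC, hCt⟩ := dyadic_lower (a := s - 1) (by linarith)
  refine ⟨N * ((4:ℝ≥0∞)^s * C), by finiteness, fun μ _ h hh => ?_⟩
  have hMm := measurable_cMax μ hh
  have wk : ∀ j : ℤ, (2:ℝ≥0∞)^j * μ {x | (2:ℝ≥0∞)^(j+1) < cMax μ h x} ≤
      N * ∫⁻ x, h x * (if (2:ℝ≥0∞)^j < h x then 1 else 0) ∂μ := by
    intro j
    refine le_trans ?_ (hN μ _ ((2:ℝ≥0∞)^j))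
    refine mul_le_mul_right (measure_mono fun x hx => ?_) _
    rw [mem_ofPred_eq, ENNReal.zpow_add (by norm_num) (by norm_num), zpow_one, mul_two] at hx
    have : cMax μ h x ≤ cMax μ (fun x => h x * (if (2:ℝ≥0∞)^j < h x then 1 else 0)) x + 2^j := by
      refine iSup_le fun k => ?_
      calc _ ≤ (∫⁻ y in Metric.closedBall x ((2:ℝ)^k), (h y * (if (2:ℝ≥0∞)^j < h y then 1 else 0) + 2^j) ∂μ) / μ (Metric.closedBall x ((2:ℝ)^k)) := by
            gcongr with y
            split_ifs with h1
            · simp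
            · simpa using h1
        _ = (∫⁻ y in Metric.closedBall x ((2:ℝ)^k), (h y * (if (2:ℝ≥0∞)^j < h y then 1 else 0)) ∂μ) / μ (Metric.closedBall x ((2:ℝ)^k)) + (2^j * μ (Metric.closedBall x ((2:ℝ)^k))) / μ (Metric.closedBall x ((2:ℝ)^k)) := by
            rw [lintegral_add_right _ measurable_const, setLIntegral_const, ENNReal.add_div]
        _ ≤ _ := by
            gcongr
            · exact le_iSup (fun k : ℤ => (∫⁻ y in Metric.closedBall x ((2:ℝ)^k), (h y * (if (2:ℝ≥0∞)^j < h y then 1 else 0)) ∂μ) / μ (Metric.closedBall x ((2:ℝ)^k))) k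
            · exact ENNReal.div_le_of_le_mul le_rfl
    by_contra hcon
    simp only [mem_ofPred_eq, not_lt] at hcon
    exact absurd (hx.trans_le (this.trans (add_le_add_left hcon _))) (lt_irrefl _)
  have hpow : ∀ j : ℤ, ((2:ℝ≥0∞)^(j+1+1))^s = (4:ℝ≥0∞)^s * ((2:ℝ≥0∞)^j)^(s-1) * (2:ℝ≥0∞)^j := by
    intro j
    rw [mul_assoc, ENNReal.rpow_sub _ _ (two_zpow_ne_zero _) (two_zpow_ne_top _), ENNReal.rpow_one,
      ENNReal.div_mul_cancel (two_zpow_ne_zero _) (two_zpow_ne_top _),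
      ← ENNReal.mul_rpow_of_nonneg _ _ (by linarith : 0 ≤ s)]
    congr 1
    rw [add_assoc, ENNReal.zpow_add (by norm_num) (by norm_num), mul_comm]
    norm_num
  calc ∫⁻ x, cMax μ h x ^ s ∂μ
      ≤ ∫⁻ x, ∑' j : ℤ, ((2:ℝ≥0∞)^(j+1+1))^s * (if (2:ℝ≥0∞)^(j+1) < cMax μ h x then 1 else 0) ∂μ := by
        refine lintegral_mono fun x => (dyadic_upper _ (by linarith)).trans_eq ?_
        exact ((Equiv.addRight (1:ℤ)).tsum_eq (fun k : ℤ => ((2:ℝ≥0∞)^(k+1))^s * (if (2:ℝ≥0∞)^k < cMax μ h x then (1:ℝ≥0∞) else 0))).symm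
    _ = ∑' j : ℤ, ((2:ℝ≥0∞)^(j+1+1))^s * μ {x | (2:ℝ≥0∞)^(j+1) < cMax μ h x} := by
        have hm : ∀ j : ℤ, MeasurableSet {x | (2:ℝ≥0∞)^(j+1) < cMax μ h x} := fun j =>
          measurableSet_lt measurable_const hMm
        rw [lintegral_tsum]
        · refine tsum_congr fun j => ?_
          rw [lintegral_const_mul _ (Measurable.ite (hm j) measurable_const measurable_const)]
          congr 1
          rw [← lintegral_indicator_one (hm j)]
          refine lintegral_congr fun x => ?_
          simp [indicator_apply]
        · intro j
          exact ((Measurable.ite (hm j) measurable_const measurable_const).const_mul _).aemeasurable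
    _ ≤ ∑' j : ℤ, (4:ℝ≥0∞)^s * ((2:ℝ≥0∞)^j)^(s-1) * (N * ∫⁻ x, h x * (if (2:ℝ≥0∞)^j < h x then 1 else 0) ∂μ) := by
        refine ENNReal.tsum_le_tsum fun j => ?_
        rw [hpow, mul_assoc]
        exact mul_le_mul_right (wk j) _
    _ = N * (4:ℝ≥0∞)^s * ∫⁻ x, ∑' j : ℤ, h x * (((2:ℝ≥0∞)^j)^(s-1) * (if (2:ℝ≥0∞)^j < h x then 1 else 0)) ∂μ := by
        have hm : ∀ j : ℤ, Measurable (fun x => if (2:ℝ≥0∞)^j < h x then (1:ℝ≥0∞) else 0) := fun j =>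
          Measurable.ite (measurableSet_lt measurable_const hh) measurable_const measurable_const
        rw [lintegral_tsum]
        · rw [← ENNReal.tsum_mul_left]
          refine tsum_congr fun j => ?_
          simp_rw [mul_left_comm (h _)]
          rw [lintegral_const_mul _ (by exact hh.mul (hm j))]
          ring
        · intro j
          exact (hh.mul ((hm j).const_mul _)).aemeasurable
    _ ≤ N * (4:ℝ≥0∞)^s * ∫⁻ x, C * h x ^ s ∂μ := by
        gcongr with x
        rw [ENNReal.tsum_mul_left]
        refine (mul_le_mul_right (hCt (h x)) _).trans_eq ?_
        rw [mul_left_comm]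
        congr 1
        have : s = 1 + (s - 1) := by ring
        conv_rhs => rw [this]
        rw [ENNReal.rpow_add_of_nonneg _ _ (by norm_num) (by linarith), ENNReal.rpow_one]
    _ = _ := by
        rw [lintegral_const_mul _ (hh.pow_const _)]; ring

end Part1

section Part2
open MeasureTheory ENNReal Set

theorem buckley (n : ℕ) {s : ℝ} (hs : 1 < s) : ∃ C : ℝ≥0∞, C ≠ ⊤ ∧
    ∀ (u σ h : Euc n → ℝ≥0∞), Measurable u → Measurable σ → Measurable h →
    (∀ᵐ x, σ x ≠ 0 ∧ σ x ≠ ⊤ ∧ u x = σ x ^ (-(1/(s-1)))) → ∀ A : ℝ≥0∞,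
    (∀ (x : Euc n) (r : ℝ), 0 < r → (volume.withDensity u) (Metric.closedBall x r) ≠ 0 ∧
      (volume.withDensity u) (Metric.closedBall x r) ≠ ⊤ ∧
      (volume.withDensity σ) (Metric.closedBall x r) ≠ 0 ∧
      (volume.withDensity σ) (Metric.closedBall x r) ≠ ⊤ ∧
      ((volume.withDensity u) (Metric.closedBall x (3*r)))^(s-1) *
      (volume.withDensity σ) (Metric.closedBall x (3*r)) ≤ A * volume (Metric.closedBall x r) ^ s) →
    ∫⁻ x, cMax volume (fun y => h y * u y) x ^ s * σ x ≤
      C * A ^ (s/(s-1)) * ∫⁻ x, h x ^ s * u x := by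
  have hs1 : 0 < s - 1 := by linarith
  have hs' : 1 < s/(s-1) := by rw [lt_div_iff₀ hs1]; linarith
  obtain ⟨C1, hC1, h1⟩ := cMax_strong (Euc n) hs
  obtain ⟨C2, hC2, h2⟩ := cMax_strong (Euc n) hs'
  refine ⟨C2 * C1, by finiteness, fun u σ h hu hσ hh hae A hA => ?_⟩
  set μ := volume.withDensity u with hμ
  set ν := volume.withDensity σ with hν
  let g : Euc n → ℝ≥0∞ := fun y => cMax μ h y ^ (s-1) * (σ y)⁻¹
  have hM : Measurable (cMax μ h) := measurable_cMax μ hh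
  have hg : Measurable g := (hM.pow_const _).mul hσ.inv
  have pt : ∀ x, cMax volume (fun y => h y * u y) x ≤ (A * cMax ν g x)^(1/(s-1)) := by
    intro x
    refine iSup_le fun k => ?_
    rw [one_div, ENNReal.le_rpow_inv_iff hs1]
    have h2k : (0:ℝ) < 2^k := by positivity
    set B := Metric.closedBall x ((2:ℝ)^k) with hB
    set B3 := Metric.closedBall x (3*(2:ℝ)^k) with hB3
    obtain ⟨-, -, hν0, hνt, hAk⟩ := hA x _ h2k
    obtain ⟨hμ0, hμt, hν30, hνTt, -⟩ := hA x _ (by positivity : (0:ℝ) < 3 * 2^k)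
    have hv0 : volume B ≠ 0 := (Metric.measure_closedBall_pos volume x h2k).ne'
    have hvt : volume B ≠ ⊤ := measure_closedBall_lt_top.ne
    have hmB : MeasurableSet B := Metric.isClosed_closedBall.measurableSet
    have hI : ∫⁻ y in B, h y * u y = ∫⁻ y in B, h y ∂μ := by
      rw [hμ, setLIntegral_withDensity_eq_setLIntegral_mul _ hu hh hmB]
      exact lintegral_congr fun y => mul_comm _ _
    have hJ : ∫⁻ y in B, g y ∂ν = ∫⁻ y in B, cMax μ h y ^ (s-1) := by
      rw [hν, setLIntegral_withDensity_eq_setLIntegral_mul _ hσ hg hmB]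
      refine lintegral_congr_ae (ae_restrict_of_ae ?_)
      filter_upwards [hae] with y ⟨hy0, hyt, _⟩
      simp only [g, Pi.mul_apply]
      rw [mul_left_comm, ENNReal.mul_inv_cancel hy0 hyt, mul_one]
    rw [hI]
    set I := ∫⁻ y in B, h y ∂μ
    have step1 : (I / μ B3)^(s-1) * volume B ≤ ∫⁻ y in B, g y ∂ν := by
      rw [hJ, ← setLIntegral_const]
      refine setLIntegral_mono' hmB fun y hy => ?_
      refine ENNReal.rpow_le_rpow ?_ hs1.le
      refine le_trans ?_ (le_iSup _ (k+1))
      have hy' : dist y x ≤ 2^k := hy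
      have e2 : (2:ℝ)^(k+1) = 2 * 2^k := by rw [zpow_add₀ (by norm_num)]; ring
      refine ENNReal.div_le_div ?_ (measure_mono ?_)
      · refine lintegral_mono_set (Metric.closedBall_subset_closedBall' ?_)
        rw [dist_comm]; linarith
      · refine Metric.closedBall_subset_closedBall' ?_
        linarith
    have step2 : (∫⁻ y in B, g y ∂ν) / ν B ≤ cMax ν g x := le_iSup (fun k : ℤ => (∫⁻ y in Metric.closedBall x ((2:ℝ)^k), g y ∂ν) / ν (Metric.closedBall x ((2:ℝ)^k))) k
    have hνB : ν B ≤ ν B3 := measure_mono (Metric.closedBall_subset_closedBall (by linarith))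
    have step3 : (μ B3 / volume B)^(s-1) ≤ A * volume B / ν B := by
      rw [ENNReal.div_rpow_of_nonneg _ _ hs1.le, ENNReal.le_div_iff_mul_le (Or.inl hν0) (Or.inl hνt),
        ENNReal.div_eq_inv_mul, mul_assoc]
      calc _ ≤ (volume B ^ (s-1))⁻¹ * (A * volume B ^ s) := by
            refine mul_le_mul_right ?_ _
            exact (mul_le_mul_right hνB _).trans hAk
        _ = _ := by
            rw [mul_left_comm, ← ENNReal.rpow_neg, ← ENNReal.rpow_add _ _ hv0 hvt]
            simp
    calc (I / volume B)^(s-1) = (I / μ B3)^(s-1) * (μ B3 / volume B)^(s-1) := by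
          rw [← ENNReal.mul_rpow_of_nonneg _ _ hs1.le]
          congr 1
          rw [ENNReal.div_eq_inv_mul, ENNReal.div_eq_inv_mul, ENNReal.div_eq_inv_mul]
          rw [show (μ B3)⁻¹ * I * ((volume B)⁻¹ * μ B3) = ((μ B3)⁻¹ * μ B3) * ((volume B)⁻¹ * I) by ring,
            ENNReal.inv_mul_cancel hμ0 hμt, one_mul]
      _ ≤ (I / μ B3)^(s-1) * (A * volume B / ν B) := by gcongr
      _ = A * (((I / μ B3)^(s-1) * volume B) / ν B) := by
          simp only [div_eq_mul_inv]; ring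
      _ ≤ A * ((∫⁻ y in B, g y ∂ν) / ν B) := by gcongr
      _ ≤ _ := by gcongr
  calc ∫⁻ x, cMax volume (fun y => h y * u y) x ^ s * σ x
      ≤ ∫⁻ x, (A ^ (s/(s-1)) * cMax ν g x^(s/(s-1))) * σ x := by
        gcongr with x
        rw [← ENNReal.mul_rpow_of_nonneg _ _ (by linarith)]
        refine (ENNReal.rpow_le_rpow (pt x) (by linarith)).trans_eq ?_
        rw [← ENNReal.rpow_mul]
        congr 1; ring
    _ = A ^ (s/(s-1)) * ∫⁻ x, cMax ν g x^(s/(s-1)) ∂ν := by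
        have hm : Measurable (cMax ν g) := measurable_cMax ν hg
        rw [hν, lintegral_withDensity_eq_lintegral_mul _ hσ (hm.pow_const _),
          ← lintegral_const_mul _ (by fun_prop)]
        refine lintegral_congr fun x => ?_
        simp only [Pi.mul_apply]; ring
    _ ≤ A ^ (s/(s-1)) * (C2 * ∫⁻ x, g x^(s/(s-1)) ∂ν) := by gcongr; exact h2 ν g hg
    _ = A ^ (s/(s-1)) * (C2 * ∫⁻ x, cMax μ h x ^ s ∂μ) := by
        congr 2
        rw [hν, hμ, lintegral_withDensity_eq_lintegral_mul _ hσ (hg.pow_const _),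
          lintegral_withDensity_eq_lintegral_mul _ hu (hM.pow_const _)]
        refine lintegral_congr_ae ?_
        filter_upwards [hae] with y ⟨hy0, hyt, hy⟩
        simp only [g, Pi.mul_apply]
        rw [ENNReal.mul_rpow_of_nonneg _ _ (by linarith), ← ENNReal.rpow_mul, hy,
          ← ENNReal.rpow_neg_one, ← ENNReal.rpow_mul, mul_left_comm, mul_comm]
        rw [mul_div_cancel₀ _ hs1.ne']
        congr 1
        nth_rewrite 1 [← ENNReal.rpow_one (σ y)]
        rw [← ENNReal.rpow_add _ _ hy0 hyt]
        congr 1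
        field_simp
        ring
    _ ≤ A ^ (s/(s-1)) * (C2 * (C1 * ∫⁻ x, h x ^ s ∂μ)) := by gcongr; exact h1 μ h hh
    _ = _ := by
        rw [hμ, lintegral_withDensity_eq_lintegral_mul _ hu (hh.pow_const _)]
        simp only [Pi.mul_apply, mul_comm (u _)]
        ring

end Part2

section Part3
open MeasureTheory ENNReal Set

theorem lintegral_dilate {n : ℕ} (G : Euc n → ℝ≥0∞) (hG : Measurable G) (x : Euc n) {t : ℝ}
    (ht : 0 < t) :
    ∫⁻ h in Metric.closedBall (0 : Euc n) 1, G (x + t • h) =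
      (ENNReal.ofReal (t^n))⁻¹ * ∫⁻ y in Metric.closedBall x t, G y := by
  have hm : MeasurableSet (Metric.closedBall x t) := Metric.isClosed_closedBall.measurableSet
  let F : Euc n → ℝ≥0∞ := fun z => (Metric.closedBall x t).indicator G (x + z)
  have hF : Measurable F := (hG.indicator hm).comp (measurable_const_add x)
  have e1 : ∫⁻ h in Metric.closedBall (0 : Euc n) 1, G (x + t • h) = ∫⁻ h, F (t • h) := by
    rw [← lintegral_indicator Metric.isClosed_closedBall.measurableSet]
    refine lintegral_congr fun h => ?_
    have : h ∈ Metric.closedBall (0 : Euc n) 1 ↔ x + t • h ∈ Metric.closedBall x t := by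
      simp [norm_smul, abs_of_pos ht, mul_le_iff_le_one_right ht]
    simp only [F]
    by_cases hh : h ∈ Metric.closedBall (0 : Euc n) 1
    · rw [indicator_of_mem hh, indicator_of_mem (this.1 hh)]
    · rw [indicator_of_notMem hh, indicator_of_notMem (fun h3 => hh (this.2 h3))]
  have e2 : ∫⁻ h, F (t • h) = ∫⁻ z, F z ∂(Measure.map (fun h : Euc n => t • h) volume) := by
    rw [lintegral_map hF (measurable_const_smul t)]
  rw [e1, e2]
  have := Measure.map_addHaar_smul (volume : Measure (Euc n)) ht.ne'
  rw [show (fun h : Euc n => t • h) = (t • ·) from rfl, this, lintegral_smul_measure,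
    lintegral_add_left_eq_self (fun z => (Metric.closedBall x t).indicator G z) x,
    lintegral_indicator hm]
  simp only [finrank_euclideanSpace, Fintype.card_fin, smul_eq_mul]
  rw [abs_of_pos (by positivity), ENNReal.ofReal_inv_of_pos (by positivity)]

theorem line_bound {n : ℕ} {f : Euc n → ℝ} {K : NNReal} (hf : LipschitzWith K f)
    (hc : HasCompactSupport f) (x h : Euc n) (h0 : h ≠ 0) (h1 : ‖h‖ ≤ 1)
    (hd : ∀ᵐ t : ℝ ∂(volume.restrict (Ioi 0)), DifferentiableAt ℝ f (x + t • h)) :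
    ENNReal.ofReal |f x| ≤ ∫⁻ t in Ioi (0:ℝ), ENNReal.ofReal ‖fderiv ℝ f (x + t • h)‖ := by
  obtain ⟨R, hR⟩ := hc.isCompact.isBounded.subset_closedBall (0 : Euc n)
  have hpos : 0 < ‖h‖ := norm_pos_iff.2 h0
  let T : ℝ := (|R| + ‖x‖ + 1) / ‖h‖
  have hT : 0 < T := by positivity
  have hfT : f (x + T • h) = 0 := by
    by_contra hne
    have := hR (subset_tsupport f hne)
    rw [mem_closedBall_zero_iff] at this
    have e : ‖T • h‖ = |R| + ‖x‖ + 1 := by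
      rw [norm_smul, Real.norm_of_nonneg hT.le]; simp only [T]; field_simp
    have := norm_sub_le (x + T • h) x
    rw [add_sub_cancel_left, e] at this
    have := le_abs_self R
    linarith
  have hg : LipschitzWith (K * (0 + ‖h‖₊)) (fun t : ℝ => f (x + t • h)) := by
    refine hf.comp ((LipschitzWith.const x).add ?_)
    refine LipschitzWith.of_dist_le_mul fun a b => ?_
    rw [dist_eq_norm, ← sub_smul, norm_smul, dist_eq_norm]
    simp [mul_comm]
  have hac := (hg.lipschitzOnWith (s := uIcc 0 T)).absolutelyContinuousOnInterval
  have hint := hac.integral_deriv_eq_sub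
  simp only [hfT, zero_smul, add_zero, zero_sub] at hint
  rw [intervalIntegral.integral_of_le hT.le] at hint
  calc ENNReal.ofReal |f x| = ‖∫ t in Ioc 0 T, deriv (fun t : ℝ => f (x + t • h)) t‖ₑ := by
        rw [hint, enorm_neg, Real.enorm_eq_ofReal_abs]
    _ ≤ ∫⁻ t in Ioc 0 T, ‖deriv (fun t : ℝ => f (x + t • h)) t‖ₑ := enorm_integral_le_lintegral_enorm _
    _ ≤ ∫⁻ t in Ioi 0, ‖deriv (fun t : ℝ => f (x + t • h)) t‖ₑ :=
        lintegral_mono_set Ioc_subset_Ioi_self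
    _ ≤ _ := by
        refine lintegral_mono_ae ?_
        filter_upwards [hd] with t ht
        have h2 : HasDerivAt (fun t : ℝ => x + t • h) h t := by
          simpa using ((hasDerivAt_id t).smul_const h).const_add x
        have h3 := (ht.hasFDerivAt.comp_hasDerivAt t h2).deriv
        have h3' : deriv (fun t : ℝ => f (x + t • h)) t = fderiv ℝ f (x + t • h) h := h3
        rw [h3', ← ofReal_norm]
        refine ENNReal.ofReal_le_ofReal (((fderiv ℝ f (x + t • h)).le_opNorm h).trans ?_)
        exact mul_le_of_le_one_right (norm_nonneg _) h1

theorem repr_bound {n : ℕ} (hn : 1 ≤ n) {f : Euc n → ℝ} {K : NNReal} (hf : LipschitzWith K f)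
    (hc : HasCompactSupport f) (x : Euc n) :
    volume (Metric.closedBall (0 : Euc n) 1) * ENNReal.ofReal |f x| ≤
      ∫⁻ t in Ioi (0:ℝ), (ENNReal.ofReal (t^n))⁻¹ *
        ∫⁻ y in Metric.closedBall x t, ENNReal.ofReal ‖fderiv ℝ f y‖ := by
  have hG : Measurable (fun y => ENNReal.ofReal ‖fderiv ℝ f y‖) :=
    (measurable_fderiv ℝ f).norm.ennreal_ofReal
  have hD : MeasurableSet {y | DifferentiableAt ℝ f y} := measurableSet_of_differentiableAt ℝ f
  have hN : volume {y | ¬ DifferentiableAt ℝ f y} = 0 := hf.ae_differentiableAt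
  have hjm : Measurable (fun z : ℝ × Euc n => x + z.1 • z.2) := by fun_prop
  have hae : ∀ᵐ h : Euc n, ∀ᵐ t : ℝ ∂(volume.restrict (Ioi 0)), DifferentiableAt ℝ f (x + t • h) := by
    rw [← Measure.ae_ae_comm (p := fun (t : ℝ) (h : Euc n) => DifferentiableAt ℝ f (x + t • h))]
    · refine (ae_restrict_iff' measurableSet_Ioi).2 (Filter.Eventually.of_forall fun t ht => ?_)
      have e : {h : Euc n | ¬ DifferentiableAt ℝ f (x + t • h)} =
        (fun h => t • h) ⁻¹' ((fun z => x + z) ⁻¹' {y | ¬ DifferentiableAt ℝ f y}) := rfl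
      rw [ae_iff, e, Measure.addHaar_preimage_smul _ (ne_of_gt ht), measure_preimage_add, hN, mul_zero]
    · exact hjm hD
  have : Nonempty (Fin n) := ⟨⟨0, hn⟩⟩
  calc volume (Metric.closedBall (0 : Euc n) 1) * ENNReal.ofReal |f x|
      = ∫⁻ h in Metric.closedBall (0 : Euc n) 1, ENNReal.ofReal |f x| := by
        rw [setLIntegral_const, mul_comm]
    _ ≤ ∫⁻ h in Metric.closedBall (0 : Euc n) 1, ∫⁻ t in Ioi (0:ℝ), ENNReal.ofReal ‖fderiv ℝ f (x + t • h)‖ := by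
        have h0 : ∀ᵐ h : Euc n, h ≠ 0 := by
          simp [ae_iff]
        refine setLIntegral_mono_ae' Metric.isClosed_closedBall.measurableSet ?_
        filter_upwards [hae, h0] with h h1 h2 h3
        exact line_bound hf hc x h h2 (mem_closedBall_zero_iff.1 h3) h1
    _ = ∫⁻ t in Ioi (0:ℝ), ∫⁻ h in Metric.closedBall (0 : Euc n) 1, ENNReal.ofReal ‖fderiv ℝ f (x + t • h)‖ := by
        rw [lintegral_lintegral_swap]
        refine Measurable.aemeasurable ?_
        exact hG.comp (hjm.comp measurable_swap)
    _ = _ := by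
        refine setLIntegral_congr_fun measurableSet_Ioi fun t ht => ?_
        exact lintegral_dilate _ hG x ht

end Part3

section Part4
open MeasureTheory ENNReal Set

theorem lintegral_tail {n : ℕ} (hn : 2 ≤ n) {R : ℝ} (hR : 0 < R) :
    ∫⁻ t in Ioi R, (ENNReal.ofReal (t^n))⁻¹ ≤ ENNReal.ofReal (R / R^n) := by
  have hn' : (2:ℝ) ≤ n := by exact_mod_cast hn
  have ha : -(n:ℝ) < -1 := by linarith
  calc ∫⁻ t in Ioi R, (ENNReal.ofReal (t^n))⁻¹ = ∫⁻ t in Ioi R, ENNReal.ofReal (t^(-(n:ℝ))) := by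
        refine setLIntegral_congr_fun measurableSet_Ioi fun t ht => ?_
        have ht0 : 0 < t := hR.trans ht
        rw [Real.rpow_neg ht0.le, Real.rpow_natCast, ENNReal.ofReal_inv_of_pos (by positivity)]
    _ = ENNReal.ofReal (∫ t in Ioi R, t^(-(n:ℝ))) := by
        rw [ofReal_integral_eq_lintegral_ofReal (integrableOn_Ioi_rpow_of_lt ha hR)]
        exact (ae_restrict_iff' measurableSet_Ioi).2 (Filter.Eventually.of_forall fun t ht =>
          Real.rpow_nonneg (hR.trans ht).le _)
    _ ≤ _ := by
        rw [integral_Ioi_rpow_of_lt ha hR]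
        apply ENNReal.ofReal_le_ofReal
        rw [Real.rpow_add hR, Real.rpow_neg hR.le, Real.rpow_natCast, Real.rpow_one]
        rw [neg_div, ← div_neg, neg_add, neg_neg]
        rw [div_le_iff₀ (by linarith)]
        have : 0 < R / R^n := by positivity
        rw [div_eq_inv_mul] at this ⊢
        nlinarith

theorem inner_bound {n : ℕ} (hn : 2 ≤ n) : ∃ C : ℝ≥0∞, C ≠ ⊤ ∧ ∀ (v : Euc n → ℝ≥0∞) 
    (E : Set (Euc n)), MeasurableSet E → ∫⁻ x in E, v x ≠ ⊤ → ∀ y : Euc n,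
    ∫⁻ t in Ioi (0:ℝ), (ENNReal.ofReal (t^n))⁻¹ * ∫⁻ x in E ∩ Metric.closedBall y t, v x ≤
      C * (∫⁻ x in E, v x) ^ (1/(n:ℝ)) * cMax volume v y ^ (1 - 1/(n:ℝ)) := by
  have hn' : (2:ℝ) ≤ n := by exact_mod_cast hn
  have hinv : 1/(n:ℝ) < 1 := by rw [div_lt_one (by linarith)]; linarith
  have hinv0 : 0 < 1/(n:ℝ) := by positivity
  set ω := volume (Metric.closedBall (0 : Euc n) 1) with hω
  have hωt : ω ≠ ⊤ := measure_closedBall_lt_top.ne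
  have hω0 : ω ≠ 0 := (Metric.measure_closedBall_pos volume _ one_pos).ne'
  refine ⟨2^n * ω + 1, by finiteness, fun v E hE hV y => ?_⟩
  set V := ∫⁻ x in E, v x with hVdef
  set M := cMax volume v y with hM
  have b1 : ∀ t, ∫⁻ x in E ∩ Metric.closedBall y t, v x ≤ V := fun t =>
    lintegral_mono_set inter_subset_left
  have b2 : ∀ t : ℝ, 0 < t → ∫⁻ x in E ∩ Metric.closedBall y t, v x ≤
      ENNReal.ofReal (t^n) * (2^n * ω * M) := by
    intro t ht
    obtain ⟨k, hk, hk'⟩ := exists_mem_Ioc_zpow ht (one_lt_two : (1:ℝ) < 2)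
    have e2 : (2:ℝ)^(k+1) ≤ 2 * t := by rw [zpow_add₀ (by norm_num)]; linarith
    have hball : (∫⁻ x in Metric.closedBall y ((2:ℝ)^(k+1)), v x) / volume (Metric.closedBall y ((2:ℝ)^(k+1))) ≤ M :=
      le_iSup (fun k : ℤ => (∫⁻ x in Metric.closedBall y ((2:ℝ)^k), v x) / volume (Metric.closedBall y ((2:ℝ)^k))) (k+1)
    have h2k : (0:ℝ) < 2^(k+1) := by positivity
    rw [ENNReal.div_le_iff (Metric.measure_closedBall_pos volume _ h2k).ne' measure_closedBall_lt_top.ne] at hball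
    calc _ ≤ ∫⁻ x in Metric.closedBall y ((2:ℝ)^(k+1)), v x :=
          lintegral_mono_set (inter_subset_right.trans (Metric.closedBall_subset_closedBall hk'))
      _ ≤ _ := hball
      _ ≤ M * volume (Metric.closedBall y (2 * t)) := by gcongr
      _ = _ := by
          rw [Measure.addHaar_closedBall' _ _ (by positivity), ← hω]
          simp only [finrank_euclideanSpace, Fintype.card_fin]
          rw [mul_pow, ENNReal.ofReal_mul (by positivity), ENNReal.ofReal_pow (by norm_num)]
          simp; ring
  rcases eq_or_ne V 0 with hV0 | hV0
  · have : ∀ t, ∫⁻ x in E ∩ Metric.closedBall y t, v x = 0 := fun t => 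
      le_antisymm ((b1 t).trans hV0.le) zero_le
    simp [this]
  have hM0 : M ≠ 0 := by
    intro h
    rw [h] at b2
    apply hV0
    have hE2 : E = ⋃ N : ℕ, E ∩ Metric.closedBall y ((N:ℝ)+1) := by
      rw [← inter_iUnion]
      symm
      rw [inter_eq_left]
      intro x _
      obtain ⟨N, hN⟩ := exists_nat_ge (dist x y)
      exact mem_iUnion.2 ⟨N, by rw [Metric.mem_closedBall]; linarith⟩
    rw [hVdef, hE2]
    refine le_antisymm ((lintegral_iUnion_le _ _).trans ?_) zero_le
    refine le_of_eq (ENNReal.tsum_eq_zero.2 fun N => le_antisymm ((b2 _ (by positivity)).trans ?_) zero_le)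
    simp
  rcases eq_or_ne M ⊤ with hMt | hMt
  · rw [hMt, ENNReal.top_rpow_of_pos (by linarith), ENNReal.mul_top]
    · exact le_top
    · refine mul_ne_zero (by simp) ?_
      simp [ENNReal.rpow_eq_zero_iff, hV0, hV]
  have hVM0 : (V / M)^(1/(n:ℝ)) ≠ 0 := by
    have : V/M ≠ 0 := ENNReal.div_ne_zero.2 ⟨hV0, hMt⟩
    have h3 : V/M ≠ ⊤ := (ENNReal.div_lt_top hV hM0).ne
    simp [ENNReal.rpow_eq_zero_iff, this, h3]
  have hVMt : (V / M)^(1/(n:ℝ)) ≠ ⊤ :=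
    ENNReal.rpow_ne_top_of_nonneg hinv0.le (ENNReal.div_lt_top hV hM0).ne
  obtain ⟨R, hR⟩ : ∃ R : ℝ, R = ((V / M)^(1/(n:ℝ))).toReal := ⟨_, rfl⟩
  have hRpos : 0 < R := hR ▸ ENNReal.toReal_pos hVM0 hVMt
  have hR' : ENNReal.ofReal R = (V / M)^(1/(n:ℝ)) := by rw [hR, ENNReal.ofReal_toReal hVMt]
  have hRn : V = M * ENNReal.ofReal (R^n) := by
    rw [ENNReal.ofReal_pow hRpos.le, hR', ← ENNReal.rpow_natCast, ← ENNReal.rpow_mul,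
      one_div, inv_mul_cancel₀ (by positivity), ENNReal.rpow_one, ENNReal.mul_div_cancel hM0 hMt]
  have hRM : ENNReal.ofReal R * M = V ^ (1/(n:ℝ)) * M ^ (1 - 1/(n:ℝ)) := by
    rw [hR', ENNReal.div_rpow_of_nonneg _ _ hinv0.le, ENNReal.rpow_sub _ _ hM0 hMt, ENNReal.rpow_one]
    simp only [div_eq_mul_inv]; ring
  rw [← Ioc_union_Ioi_eq_Ioi hRpos.le]
  refine (lintegral_union_le _ _ _).trans ?_
  have p1 : ∫⁻ t in Ioc 0 R, (ENNReal.ofReal (t^n))⁻¹ * ∫⁻ x in E ∩ Metric.closedBall y t, v x ≤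
      2^n * ω * (ENNReal.ofReal R * M) := by
    calc _ ≤ ∫⁻ t in Ioc 0 R, (2^n * ω * M) := by
          refine setLIntegral_mono' measurableSet_Ioc fun t ht => ?_
          have h0 : ENNReal.ofReal (t^n) ≠ 0 := by
            have : 0 < t^n := by have := ht.1; positivity
            simpa using this
          rw [ENNReal.inv_mul_le_iff h0 ENNReal.ofReal_ne_top]
          exact b2 t ht.1
      _ = _ := by
          rw [setLIntegral_const, Real.volume_Ioc, sub_zero]; ring
  have p2 : ∫⁻ t in Ioi R, (ENNReal.ofReal (t^n))⁻¹ * ∫⁻ x in E ∩ Metric.closedBall y t, v x ≤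
      ENNReal.ofReal R * M := by
    calc _ ≤ ∫⁻ t in Ioi R, V * (ENNReal.ofReal (t^n))⁻¹ := by
          refine lintegral_mono fun t => ?_
          rw [mul_comm]
          gcongr
          exact b1 t
      _ = V * ∫⁻ t in Ioi R, (ENNReal.ofReal (t^n))⁻¹ := by
          rw [lintegral_const_mul _ (by fun_prop)]
      _ ≤ V * ENNReal.ofReal (R / R^n) := by gcongr; exact lintegral_tail hn hRpos
      _ = _ := by
          rw [hRn, mul_assoc, ← ENNReal.ofReal_mul (by positivity), mul_comm M]
          congr 2; field_simp
  calc _ ≤ 2^n * ω * (ENNReal.ofReal R * M) + ENNReal.ofReal R * M := add_le_add p1 p2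
    _ = (2^n * ω + 1) * (ENNReal.ofReal R * M) := by ring
    _ = _ := by rw [hRM, mul_assoc]

theorem weak_sobolev {n : ℕ} (hn : 2 ≤ n) : ∃ C : ℝ≥0∞, C ≠ ⊤ ∧ ∀ (v : Euc n → ℝ≥0∞), Measurable v →
    ∀ (f : Euc n → ℝ) (K : NNReal), LipschitzWith K f → HasCompactSupport f →
    ∀ l : ℝ≥0∞, l ≠ ⊤ → ∫⁻ x in {x | l ≤ ENNReal.ofReal |f x|}, v x ≠ ⊤ →
    l * (∫⁻ x in {x | l ≤ ENNReal.ofReal |f x|}, v x)^(1 - 1/(n:ℝ)) ≤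
      C * ∫⁻ y, ENNReal.ofReal ‖fderiv ℝ f y‖ * cMax volume v y ^ (1 - 1/(n:ℝ)) := by
  have hn' : (2:ℝ) ≤ n := by exact_mod_cast hn
  have hinv : 1/(n:ℝ) < 1 := by rw [div_lt_one (by linarith)]; linarith
  have hinv0 : 0 < 1/(n:ℝ) := by positivity
  obtain ⟨C, hC, hCb⟩ := inner_bound hn
  set ω := volume (Metric.closedBall (0 : Euc n) 1) with hω
  have hωt : ω ≠ ⊤ := measure_closedBall_lt_top.ne
  have hω0 : ω ≠ 0 := (Metric.measure_closedBall_pos volume _ one_pos).ne'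
  refine ⟨ω⁻¹ * C, by finiteness, fun v hv f K hf hc l hl hV => ?_⟩
  set E := {x | l ≤ ENNReal.ofReal |f x|} with hEdef
  have hE : MeasurableSet E :=
    measurableSet_le measurable_const hf.continuous.measurable.abs.ennreal_ofReal
  set V := ∫⁻ x in E, v x with hVdef
  have hM : Measurable (cMax volume v) := measurable_cMax volume hv
  rcases eq_or_ne V 0 with hV0 | hV0
  · rw [hV0, ENNReal.zero_rpow_of_pos (by linarith), mul_zero]; exact zero_le
  set G : Euc n → ℝ≥0∞ := fun y => ENNReal.ofReal ‖fderiv ℝ f y‖ with hGdef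
  have hG : Measurable G := (measurable_fderiv ℝ f).norm.ennreal_ofReal
  -- the joint kernel
  let D : Set (ℝ × Euc n × Euc n) := {z | dist z.2.2 z.2.1 ≤ z.1}
  have hD : MeasurableSet D := (isClosed_le (by fun_prop) (by fun_prop)).measurableSet
  let H : ℝ → Euc n → Euc n → ℝ≥0∞ := fun t x y =>
    (ENNReal.ofReal (t^n))⁻¹ * (v x * (G y * D.indicator 1 (t, x, y)))
  have hH : Measurable (fun z : ℝ × Euc n × Euc n => H z.1 z.2.1 z.2.2) := by
    have : Measurable (D.indicator (1 : ℝ × Euc n × Euc n → ℝ≥0∞)) := measurable_one.indicator hD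
    refine Measurable.mul (by fun_prop) (Measurable.mul (by fun_prop) (Measurable.mul (by fun_prop) ?_))
    exact this
  have ind1 : ∀ t x y, D.indicator (1 : ℝ × Euc n × Euc n → ℝ≥0∞) (t, x, y) = (Metric.closedBall x t).indicator 1 y :=
    fun t x y => rfl
  have ind2 : ∀ t x y, D.indicator (1 : ℝ × Euc n × Euc n → ℝ≥0∞) (t, x, y) = (Metric.closedBall y t).indicator 1 x := by
    intro t x y
    rw [ind1]
    by_cases h : dist y x ≤ t
    · rw [indicator_of_mem (by exact h), indicator_of_mem (by rw [Metric.mem_closedBall, dist_comm]; exact h)]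
      rfl
    · rw [indicator_of_notMem (by exact h), indicator_of_notMem (by rw [Metric.mem_closedBall, dist_comm]; exact h)]
  have main : ω * (l * V) ≤ C * V^(1/(n:ℝ)) * ∫⁻ y, G y * cMax volume v y ^ (1 - 1/(n:ℝ)) := by
    calc ω * (l * V) = ∫⁻ x in E, ω * (l * v x) := by
          rw [lintegral_const_mul _ (by fun_prop), lintegral_const_mul _ hv]
      _ ≤ ∫⁻ x in E, ∫⁻ t in Ioi (0:ℝ), ∫⁻ y, H t x y := by
          refine setLIntegral_mono' hE fun x hx => ?_
          have hx' : l ≤ ENNReal.ofReal |f x| := hx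
          have := repr_bound (by omega) hf hc x
          calc ω * (l * v x) ≤ v x * (ω * ENNReal.ofReal |f x|) := by
                rw [← mul_assoc, mul_comm]; gcongr
            _ ≤ v x * ∫⁻ t in Ioi (0:ℝ), (ENNReal.ofReal (t^n))⁻¹ * ∫⁻ y in Metric.closedBall x t, G y := by
                gcongr
            _ ≤ ∫⁻ t in Ioi (0:ℝ), v x * ((ENNReal.ofReal (t^n))⁻¹ * ∫⁻ y in Metric.closedBall x t, G y) := by
                exact lintegral_const_mul_le _ _
            _ = _ := by
                refine lintegral_congr fun t => ?_
                simp only [H]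
                have hmt : Measurable (fun y => D.indicator (1 : ℝ × Euc n × Euc n → ℝ≥0∞) (t, x, y)) :=
                  (measurable_one.indicator hD).comp (by fun_prop)
                rw [lintegral_const_mul _ (by fun_prop), lintegral_const_mul _ (by fun_prop),
                  ← lintegral_indicator Metric.isClosed_closedBall.measurableSet, mul_left_comm]
                congr 2
                refine lintegral_congr fun y => ?_
                rw [ind1]
                by_cases h : y ∈ Metric.closedBall x t
                · simp [indicator_of_mem h]
                · simp [indicator_of_notMem h]
      _ = ∫⁻ x in E, ∫⁻ y, ∫⁻ t in Ioi (0:ℝ), H t x y := by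
          refine lintegral_congr fun x => ?_
          rw [lintegral_lintegral_swap]
          refine Measurable.aemeasurable ?_
          exact hH.comp (g := fun z : ℝ × Euc n × Euc n => H z.1 z.2.1 z.2.2) (f := fun z : ℝ × Euc n => (z.1, x, z.2)) (by fun_prop)
      _ = ∫⁻ y, ∫⁻ x in E, ∫⁻ t in Ioi (0:ℝ), H t x y := by
          rw [lintegral_lintegral_swap]
          refine Measurable.aemeasurable ?_
          refine Measurable.lintegral_prod_right' (f := fun z : (Euc n × Euc n) × ℝ => H z.2 z.1.1 z.1.2) ?_
          exact hH.comp (g := fun z : ℝ × Euc n × Euc n => H z.1 z.2.1 z.2.2) (f := fun z : (Euc n × Euc n) × ℝ => (z.2, z.1.1, z.1.2)) (by fun_prop)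
      _ = ∫⁻ y, ∫⁻ t in Ioi (0:ℝ), ∫⁻ x in E, H t x y := by
          refine lintegral_congr fun y => ?_
          rw [lintegral_lintegral_swap]
          refine Measurable.aemeasurable ?_
          exact hH.comp (g := fun z : ℝ × Euc n × Euc n => H z.1 z.2.1 z.2.2) (f := fun z : Euc n × ℝ => (z.2, z.1, y)) (by fun_prop)
      _ = ∫⁻ y, G y * ∫⁻ t in Ioi (0:ℝ), (ENNReal.ofReal (t^n))⁻¹ * ∫⁻ x in E ∩ Metric.closedBall y t, v x := by
          refine lintegral_congr fun y => ?_
          rw [← lintegral_const_mul' _ _ ENNReal.ofReal_ne_top]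
          refine lintegral_congr fun t => ?_
          simp only [H]
          have hmt : Measurable (fun x => D.indicator (1 : ℝ × Euc n × Euc n → ℝ≥0∞) (t, x, y)) :=
            (measurable_one.indicator hD).comp (by fun_prop)
          rw [lintegral_const_mul _ (by fun_prop), mul_left_comm]
          congr 1
          rw [← lintegral_const_mul' _ _ ENNReal.ofReal_ne_top, inter_comm, ← setLIntegral_indicator Metric.isClosed_closedBall.measurableSet]
          refine lintegral_congr fun x => ?_
          rw [ind2]
          by_cases h : x ∈ Metric.closedBall y t
          · rw [indicator_of_mem h, indicator_of_mem h, Pi.one_apply, mul_one, mul_comm]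
          · simp [indicator_of_notMem h]
      _ ≤ ∫⁻ y, G y * (C * V^(1/(n:ℝ)) * cMax volume v y ^ (1 - 1/(n:ℝ))) := by
          gcongr with y
          exact hCb v E hE hV y
      _ = _ := by
          rw [← lintegral_const_mul _ (by fun_prop)]
          refine lintegral_congr fun y => ?_
          ring
  have hVp0 : V^(1/(n:ℝ)) ≠ 0 := by simp [ENNReal.rpow_eq_zero_iff, hV0, hV]
  have hVpt : V^(1/(n:ℝ)) ≠ ⊤ := ENNReal.rpow_ne_top_of_nonneg hinv0.le hV
  have hsplit : V = V^(1/(n:ℝ)) * V^(1 - 1/(n:ℝ)) := by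
    rw [← ENNReal.rpow_add _ _ hV0 hV]; simp
  rw [mul_assoc, ← ENNReal.div_eq_inv_mul, ENNReal.le_div_iff_mul_le (Or.inl hω0) (Or.inl hωt)]
  rw [← ENNReal.mul_le_mul_iff_right hVp0 hVpt]
  calc _ = ω * (l * (V^(1/(n:ℝ)) * V^(1 - 1/(n:ℝ)))) := by ring
    _ = ω * (l * V) := by rw [← hsplit]
    _ ≤ _ := main
    _ = _ := by ring

end Part4

section Part5
open MeasureTheory ENNReal Set

theorem fderiv_le_of_dom {n : ℕ} {f g : Euc n → ℝ} {y : Euc n} (hf : DifferentiableAt ℝ f y)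
    (h : ∀ z, |g z - g y| ≤ |f z - f y|) : ‖fderiv ℝ g y‖ ≤ ‖fderiv ℝ f y‖ := by
  by_cases hg : DifferentiableAt ℝ g y
  · refine ContinuousLinearMap.opNorm_le_bound _ (norm_nonneg _) fun v => ?_
    have h1 := (hg.hasFDerivAt.hasLineDerivAt v)
    have h2 := (hf.hasFDerivAt.hasLineDerivAt v)
    have t1 := (hasDerivAt_iff_tendsto_slope_zero.1 h1).norm
    have t2 := (hasDerivAt_iff_tendsto_slope_zero.1 h2).norm
    refine le_trans (le_of_tendsto_of_tendsto' t1 t2 fun t => ?_) ((fderiv ℝ f y).le_opNorm v)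
    simp only [zero_add, zero_smul, add_zero, norm_smul, Real.norm_eq_abs]
    exact mul_le_mul_of_nonneg_left (h _) (by positivity)
  · rw [fderiv_zero_of_not_differentiableAt hg, norm_zero]; exact norm_nonneg _

def trunc (a s : ℝ) : ℝ := min (max (|s| - a) 0) a

theorem trunc_dom (a s t : ℝ) : |trunc a s - trunc a t| ≤ |s - t| := by
  unfold trunc
  have h1 := abs_min_sub_min_le_max (max (|s| - a) 0) a (max (|t| - a) 0) a
  have h2 := abs_max_sub_max_le_max (|s| - a) 0 (|t| - a) 0
  have h3 := abs_abs_sub_abs_le s t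
  simp only [sub_sub_sub_cancel_right, sub_self, abs_zero] at h1 h2
  have h4 : max |(|s| - |t|)| 0 ≤ |s - t| := max_le h3 (abs_nonneg _)
  refine h1.trans (max_le (h2.trans h4) (abs_nonneg _))

theorem tsum_rpow_le (b : ℤ → ℝ≥0∞) {r : ℝ} (hr : 1 ≤ r) : ∑' k, b k ^ r ≤ (∑' k, b k)^r := by
  have e : ∀ x : ℝ≥0∞, x ^ r = x * x^(r-1) := fun x => by
    nth_rewrite 2 [← ENNReal.rpow_one x]
    rw [← ENNReal.rpow_add_of_nonneg _ _ (by norm_num) (by linarith)]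
    congr 1; ring
  rw [e, ← ENNReal.tsum_mul_right]
  refine ENNReal.tsum_le_tsum fun k => ?_
  rw [e]
  exact mul_le_mul_right (ENNReal.rpow_le_rpow (ENNReal.le_tsum k) (by linarith)) _

theorem overlap (F : ℝ≥0∞) (hF : F ≠ ⊤) :
    ∑' k : ℤ, (if (2:ℝ≥0∞)^k ≤ F ∧ F ≤ (2:ℝ≥0∞)^(k+1) then (1:ℝ≥0∞) else 0) ≤ 2 := by
  rcases eq_or_ne F 0 with rfl | h0
  · simp [(two_zpow_ne_zero _)]
  obtain ⟨k, hk, hk'⟩ := ENNReal.exists_mem_Ioc_zpow h0 hF (y := 2) (by norm_num) (by norm_num)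
  have mono : ∀ {a b : ℤ}, (2:ℝ≥0∞)^a ≤ (2:ℝ≥0∞)^b → a ≤ b := by
    intro a b hab
    by_contra h
    push Not at h
    have h1 : (2:ℝ≥0∞)^(b+1) ≤ (2:ℝ≥0∞)^a := ENNReal.zpow_le_of_le (by norm_num) (by omega)
    have h2 := h1.trans hab
    rw [ENNReal.zpow_add (by norm_num) (by norm_num), zpow_one] at h2
    have h3 : (2:ℝ≥0∞)^b * 1 < (2:ℝ≥0∞)^b * 2 :=
      ENNReal.mul_lt_mul_right (two_zpow_ne_zero _) (two_zpow_ne_top _) (by norm_num)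
    rw [mul_one] at h3
    exact absurd h2 (not_le.2 h3)
  rw [tsum_eq_sum (s := {k, k+1})]
  · rw [Finset.sum_pair (by omega)]
    calc _ ≤ (1:ℝ≥0∞) + 1 := by gcongr <;> split_ifs <;> simp
      _ = 2 := by norm_num
  · intro j hj
    simp only [Finset.mem_insert, Finset.mem_singleton, not_or] at hj
    rw [if_neg]
    rintro ⟨h1, h2⟩
    have a1 := mono (h1.trans hk')
    have a2 : k < j + 1 := by
      by_contra h
      have := ENNReal.zpow_le_of_le (x := 2) (by norm_num) (not_lt.1 h)
      exact absurd (hk.trans_le h2) (not_lt.2 this)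
    omega

theorem ofReal_two_zpow (k : ℤ) : ENNReal.ofReal ((2:ℝ)^k) = (2:ℝ≥0∞)^k := by
  rw [← Real.rpow_intCast, ← ENNReal.rpow_intCast, ← ENNReal.ofReal_rpow_of_pos (by norm_num)]
  simp

theorem strong_sobolev {n : ℕ} (hn : 2 ≤ n) : ∃ C : ℝ≥0∞, C ≠ ⊤ ∧ ∀ (v : Euc n → ℝ≥0∞), Measurable v →
    ∀ (f : Euc n → ℝ) (K : NNReal), LipschitzWith K f → HasCompactSupport f →
    ∫⁻ x in tsupport f, v x ≠ ⊤ →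
    (∫⁻ x, ENNReal.ofReal |f x| ^ (1/(1 - 1/(n:ℝ))) * v x)^(1 - 1/(n:ℝ)) ≤
      C * ∫⁻ y, ENNReal.ofReal ‖fderiv ℝ f y‖ * cMax volume v y ^ (1 - 1/(n:ℝ)) := by
  have hn' : (2:ℝ) ≤ n := by exact_mod_cast hn
  have hinv : 1/(n:ℝ) < 1 := by rw [div_lt_one (by linarith)]; linarith
  have hinv0 : 0 < 1/(n:ℝ) := by positivity
  obtain ⟨C, hC, hCb⟩ := weak_sobolev hn
  set θ : ℝ := 1 - 1/(n:ℝ) with hθ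
  have hθ0 : 0 < θ := by linarith
  have hr : 1 ≤ 1/θ := by rw [le_div_iff₀ hθ0]; linarith
  have hr0 : 0 ≤ 1/θ := by linarith
  refine ⟨4 * (C * 2), by finiteness, fun v hv f K hf hc hV => ?_⟩
  have hM : Measurable (cMax volume v) := measurable_cMax volume hv
  have hfm : Measurable (fun x => ENNReal.ofReal |f x|) := hf.continuous.measurable.abs.ennreal_ofReal
  set G : Euc n → ℝ≥0∞ := fun y => ENNReal.ofReal ‖fderiv ℝ f y‖ with hGdef
  have hG : Measurable G := (measurable_fderiv ℝ f).norm.ennreal_ofReal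
  let χ : ℤ → Euc n → ℝ≥0∞ := fun k y =>
    if (2:ℝ≥0∞)^k ≤ ENNReal.ofReal |f y| ∧ ENNReal.ofReal |f y| ≤ (2:ℝ≥0∞)^(k+1) then 1 else 0
  have hχ : ∀ k, Measurable (χ k) := fun k => Measurable.ite
    ((measurableSet_le measurable_const hfm).inter (measurableSet_le hfm measurable_const))
    measurable_const measurable_const
  let b : ℤ → ℝ≥0∞ := fun k => ∫⁻ y, G y * cMax volume v y ^ θ * χ k y
  have key : ∀ k : ℤ, (2:ℝ≥0∞)^k * (∫⁻ x in {x | (2:ℝ≥0∞)^(k+1) < ENNReal.ofReal |f x|}, v x)^θ ≤ C * b k := by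
    intro k
    have h2k : (0:ℝ) < 2^k := by positivity
    let g : Euc n → ℝ := fun x => trunc (2^k) (f x)
    have hgdom : ∀ x z, |g z - g x| ≤ |f z - f x| := fun x z => trunc_dom _ _ _
    have hg : LipschitzWith K g := LipschitzWith.of_dist_le_mul fun x z =>
      (hgdom z x).trans (hf.dist_le_mul x z)
    have hg0 : ∀ x, f x = 0 → g x = 0 := by
      intro x hx
      simp only [g, hx, trunc, abs_zero]
      rw [max_eq_right (by linarith), min_eq_left h2k.le]
    have hgc : HasCompactSupport g := hc.mono fun x hx hfx => hx (hg0 x hfx)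
    have hsub : {x | (2:ℝ≥0∞)^(k+1) < ENNReal.ofReal |f x|} ⊆ {x | (2:ℝ≥0∞)^k ≤ ENNReal.ofReal |g x|} := by
      intro x hx
      have hx' : (2:ℝ≥0∞)^(k+1) < ENNReal.ofReal |f x| := hx
      rw [← ofReal_two_zpow, ENNReal.ofReal_lt_ofReal_iff_of_nonneg (by positivity), zpow_add₀ (by norm_num)] at hx'
      change (2:ℝ≥0∞)^k ≤ ENNReal.ofReal |g x|
      rw [← ofReal_two_zpow]
      refine ENNReal.ofReal_le_ofReal (le_trans ?_ (le_abs_self _))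
      exact le_min (le_max_of_le_left (by linarith)) le_rfl
    have hsub2 : {x | (2:ℝ≥0∞)^k ≤ ENNReal.ofReal |g x|} ⊆ tsupport f := by
      intro x hx
      refine subset_tsupport f fun hfx => ?_
      have hx' : (2:ℝ≥0∞)^k ≤ ENNReal.ofReal |g x| := hx
      rw [hg0 x hfx] at hx'
      simp [two_zpow_ne_zero] at hx'
    have hgV : ∫⁻ x in {x | (2:ℝ≥0∞)^k ≤ ENNReal.ofReal |g x|}, v x ≠ ⊤ :=
      ne_top_of_le_ne_top hV (lintegral_mono_set hsub2)
    calc _ ≤ (2:ℝ≥0∞)^k * (∫⁻ x in {x | (2:ℝ≥0∞)^k ≤ ENNReal.ofReal |g x|}, v x)^θ := by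
          refine mul_le_mul_right (ENNReal.rpow_le_rpow (lintegral_mono_set hsub) hθ0.le) _
      _ ≤ C * ∫⁻ y, ENNReal.ofReal ‖fderiv ℝ g y‖ * cMax volume v y ^ θ :=
          hCb v hv g K hg hgc _ (two_zpow_ne_top k) hgV
      _ ≤ _ := by
          refine mul_le_mul_right (lintegral_mono_ae ?_) _
          filter_upwards [hf.ae_differentiableAt] with y hy
          by_cases hc1 : (2:ℝ≥0∞)^k ≤ ENNReal.ofReal |f y| ∧ ENNReal.ofReal |f y| ≤ (2:ℝ≥0∞)^(k+1)
          · simp only [χ, if_pos hc1, mul_one]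
            refine mul_le_mul_left (ENNReal.ofReal_le_ofReal ?_) _
            exact fderiv_le_of_dom hy (hgdom y)
          · have hz : fderiv ℝ g y = 0 := by
              rw [not_and_or, not_le, not_le] at hc1
              have hcont : Continuous (fun z => |f z|) := hf.continuous.abs
              rcases hc1 with h1 | h1
              · rw [← ofReal_two_zpow, ENNReal.ofReal_lt_ofReal_iff_of_nonneg (abs_nonneg _)] at h1
                have : g =ᶠ[nhds y] fun _ => (0:ℝ) := by
                  filter_upwards [hcont.continuousAt.eventually_lt continuousAt_const h1] with z hz
                  simp only [g, trunc]
                  rw [max_eq_right (by linarith), min_eq_left h2k.le]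
                rw [this.fderiv_eq]; simp
              · rw [← ofReal_two_zpow, ENNReal.ofReal_lt_ofReal_iff_of_nonneg (by positivity), zpow_add₀ (by norm_num), zpow_one] at h1
                have : g =ᶠ[nhds y] fun _ => ((2:ℝ)^k) := by
                  filter_upwards [continuousAt_const.eventually_lt hcont.continuousAt h1] with z hz
                  simp only [g, trunc]
                  rw [min_eq_right]
                  exact le_max_of_le_left (by linarith)
                rw [this.fderiv_eq]; simp
            rw [hz]; simp
  have hbsum : ∑' k, b k ≤ 2 * ∫⁻ y, G y * cMax volume v y ^ θ := by
    have e1 : ∑' k, b k = ∫⁻ y, ∑' k, G y * cMax volume v y ^ θ * χ k y :=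
      (lintegral_tsum fun k => ((hG.mul (hM.pow_const _)).mul (hχ k)).aemeasurable).symm
    rw [e1, ← lintegral_const_mul 2 (by exact hG.mul (hM.pow_const _))]
    refine lintegral_mono fun y => ?_
    rw [ENNReal.tsum_mul_left, mul_comm]
    exact mul_le_mul_left (overlap _ ENNReal.ofReal_ne_top) _
  have hms : ∀ k : ℤ, MeasurableSet {x | (2:ℝ≥0∞)^k < ENNReal.ofReal |f x|} := fun k =>
    measurableSet_lt measurable_const hfm
  have hpow : ∀ k : ℤ, ((2:ℝ≥0∞)^(k+1+1)) = 4 * (2:ℝ≥0∞)^k := by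
    intro k
    rw [add_assoc, ENNReal.zpow_add (by norm_num) (by norm_num), mul_comm]
    norm_num
  have hinvr : θ * (1/θ) = 1 := by field_simp
  have total : ∫⁻ x, ENNReal.ofReal |f x| ^ (1/θ) * v x ≤ (4 * (C * ∑' k, b k)) ^ (1/θ) := by
    calc _ ≤ ∫⁻ x, ∑' k : ℤ, ((2:ℝ≥0∞)^(k+1+1))^(1/θ) * {x | (2:ℝ≥0∞)^(k+1) < ENNReal.ofReal |f x|}.indicator v x := by
          refine lintegral_mono fun x => ?_
          refine (mul_le_mul_left (dyadic_upper _ (by linarith)) _).trans_eq ?_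
          have sh : ∑' k : ℤ, ((2:ℝ≥0∞)^(k+1))^(1/θ) * (if (2:ℝ≥0∞)^k < ENNReal.ofReal |f x| then 1 else 0)
              = ∑' k : ℤ, ((2:ℝ≥0∞)^(k+1+1))^(1/θ) * (if (2:ℝ≥0∞)^(k+1) < ENNReal.ofReal |f x| then 1 else 0) :=
            ((Equiv.addRight (1:ℤ)).tsum_eq (fun k : ℤ => ((2:ℝ≥0∞)^(k+1))^(1/θ) * (if (2:ℝ≥0∞)^k < ENNReal.ofReal |f x| then (1:ℝ≥0∞) else 0))).symm
          rw [sh, ← ENNReal.tsum_mul_right]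
          refine tsum_congr fun k => ?_
          rw [mul_assoc]
          congr 1
          by_cases h : (2:ℝ≥0∞)^(k+1) < ENNReal.ofReal |f x|
          · rw [indicator_of_mem (by exact h), if_pos h, one_mul]
          · rw [indicator_of_notMem (by exact h), if_neg h, zero_mul]
      _ = ∑' k : ℤ, ((2:ℝ≥0∞)^(k+1+1))^(1/θ) * ∫⁻ x in {x | (2:ℝ≥0∞)^(k+1) < ENNReal.ofReal |f x|}, v x := by
          rw [lintegral_tsum fun k => ((hv.indicator (hms (k+1))).const_mul _).aemeasurable]
          refine tsum_congr fun k => ?_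
          rw [lintegral_const_mul _ (hv.indicator (hms (k+1))), lintegral_indicator (hms (k+1))]
      _ ≤ ∑' k : ℤ, (4 * (C * b k))^(1/θ) := by
          refine ENNReal.tsum_le_tsum fun k => ?_
          set W := ∫⁻ x in {x | (2:ℝ≥0∞)^(k+1) < ENNReal.ofReal |f x|}, v x with hW
          have : W = (W^θ)^(1/θ) := by rw [← ENNReal.rpow_mul, hinvr, ENNReal.rpow_one]
          rw [this, ← ENNReal.mul_rpow_of_nonneg _ _ hr0, hpow, mul_assoc]
          refine ENNReal.rpow_le_rpow (mul_le_mul_right (key k) _) hr0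
      _ ≤ (∑' k : ℤ, (4 * (C * b k)))^(1/θ) := tsum_rpow_le _ hr
      _ = _ := by rw [ENNReal.tsum_mul_left, ENNReal.tsum_mul_left]
  calc _ ≤ ((4 * (C * ∑' k, b k)) ^ (1/θ))^θ := ENNReal.rpow_le_rpow total hθ0.le
    _ = 4 * (C * ∑' k, b k) := by
        rw [← ENNReal.rpow_mul, mul_comm (1/θ) θ, hinvr, ENNReal.rpow_one]
    _ ≤ 4 * (C * (2 * ∫⁻ y, G y * cMax volume v y ^ θ)) := by gcongr
    _ = _ := by ring

end Part5

section Part6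
open MeasureTheory ENNReal Set

def ctr {n : ℕ} (x : Euc n) (r : ℝ) : Euc n := WithLp.toLp 2 (fun i => x i - r)

theorem measurableSet_Cube {n : ℕ} (a : Euc n) (h : ℝ) : MeasurableSet (Cube a h) := by
  have : Cube a h = ⋂ i, {x : Euc n | a i ≤ x i ∧ x i ≤ a i + h} := by ext x; simp [Cube]
  rw [this]
  refine MeasurableSet.iInter fun i => ?_
  have hm : Measurable (fun x : Euc n => x i) := by fun_prop
  exact (measurableSet_le measurable_const hm).inter (measurableSet_le hm measurable_const)

theorem volume_Cube {n : ℕ} (a : Euc n) (h : ℝ) : volume (Cube a h) = ENNReal.ofReal h ^ n := by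
  have e : Cube a h = (WithLp.ofLp : Euc n → (Fin n → ℝ)) ⁻¹' (Icc (WithLp.ofLp a) (fun i => a i + h)) := by
    ext x
    simp [Cube, Pi.le_def, forall_and]
  rw [e, (PiLp.volume_preserving_ofLp (Fin n)).measure_preimage measurableSet_Icc.nullMeasurableSet,
    Real.volume_Icc_pi]
  simp

theorem ball_sub_Cube {n : ℕ} (x : Euc n) (r : ℝ) : Metric.closedBall x r ⊆ Cube (ctr x r) (2*r) := by
  intro y hy i
  rw [Metric.mem_closedBall, dist_eq_norm] at hy
  have h1 := (PiLp.norm_apply_le (y - x) i).trans hy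
  rw [PiLp.sub_apply, Real.norm_eq_abs, abs_le] at h1
  simp only [ctr]
  constructor <;> linarith [h1.1, h1.2]

/-- the dimensional constant -/
def dimC (n : ℕ) : ℝ≥0∞ := 6^n * (volume (Metric.ball (0 : Euc n) 1))⁻¹

theorem dimC_ne_top (n : ℕ) : dimC n ≠ ⊤ := by
  have : volume (Metric.ball (0 : Euc n) 1) ≠ 0 := (Metric.measure_ball_pos _ _ one_pos).ne'
  exact ENNReal.mul_ne_top (by finiteness) (ENNReal.inv_ne_top.2 this)

theorem volume_Cube6 {n : ℕ} (a y : Euc n) {r : ℝ} (hr : 0 < r) :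
    volume (Cube a (2*(3*r))) = dimC n * volume (Metric.closedBall y r) := by
  have h0 : volume (Metric.ball (0 : Euc n) 1) ≠ 0 := (Metric.measure_ball_pos _ _ one_pos).ne'
  have ht : volume (Metric.ball (0 : Euc n) 1) ≠ ⊤ := measure_ball_lt_top.ne
  rw [volume_Cube, Measure.addHaar_closedBall _ _ hr.le, dimC, finrank_euclideanSpace_fin]
  rw [show 2*(3*r) = 6 * r by ring, ENNReal.ofReal_mul (by norm_num), mul_pow, ENNReal.ofReal_pow hr.le]
  set B := volume (Metric.ball (0 : Euc n) 1)
  calc _ = ENNReal.ofReal 6 ^ n * ENNReal.ofReal r ^ n * (B * B⁻¹) := by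
        rw [ENNReal.mul_inv_cancel h0 ht, mul_one]
    _ = _ := by rw [show ENNReal.ofReal 6 = 6 by simp]; ring

theorem setlint_ne_zero {n : ℕ} {g : Euc n → ℝ≥0∞} (hg : Measurable g) {S : Set (Euc n)}
    (hS : volume S ≠ 0) (h : ∀ᵐ x, g x ≠ 0) : ∫⁻ x in S, g x ≠ 0 := by
  intro h0
  rw [lintegral_eq_zero_iff hg] at h0
  have h1 : ∀ᵐ x ∂(volume.restrict S), g x ≠ 0 := ae_restrict_of_ae h
  have : ∀ᵐ x ∂(volume.restrict S), False := by
    filter_upwards [h0, h1] with x a b using b a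
  rw [Filter.eventually_false_iff_eq_bot, ae_eq_bot, Measure.restrict_eq_zero] at this
  exact hS this

/-- second factor in the weight condition -/
def sec {n : ℕ} (p q : ℝ) (w : Euc n → ℝ) (a : Euc n) (h : ℝ) : ℝ≥0∞ :=
  if p = 1 then
    (essSup (fun x => (ENNReal.ofReal (w x))⁻¹) (volume.restrict (Cube a h))) ^ q
  else
    ((volume (Cube a h))⁻¹ * ∫⁻ x in Cube a h,
      ENNReal.ofReal (w x) ^ (-(dualExp p))) ^ (q / dualExp p)

theorem le_Apq {n : ℕ} (p q : ℝ) (w : Euc n → ℝ) (a : Euc n) {h : ℝ} (hh : 0 < h) :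
    ((volume (Cube a h))⁻¹ * ∫⁻ x in Cube a h, ENNReal.ofReal (w x) ^ q) * sec p q w a h ≤ Apq p q w :=
  le_iSup_of_le a (le_iSup_of_le h (le_iSup_of_le hh le_rfl))

theorem volume_Cube_ne_zero {n : ℕ} (a : Euc n) {h : ℝ} (hh : 0 < h) : volume (Cube a h) ≠ 0 := by
  rw [volume_Cube]; exact pow_ne_zero _ (by simpa using hh)

theorem volume_Cube_ne_top {n : ℕ} (a : Euc n) (h : ℝ) : volume (Cube a h) ≠ ⊤ := by
  rw [volume_Cube]; finiteness

theorem dualExp_pos {p : ℝ} (hp : 1 ≤ p) (hp1 : p ≠ 1) : 0 < dualExp p := by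
  have : 1 < p := lt_of_le_of_ne hp (Ne.symm hp1)
  unfold dualExp
  exact div_pos (by linarith) (by linarith)

theorem sec_ne_zero {n : ℕ} {p q : ℝ} (hp : 1 ≤ p) (hq : 0 < q) {w : Euc n → ℝ} (hw : Measurable w)
    (a : Euc n) {h : ℝ} (hh : 0 < h) : sec p q w a h ≠ 0 := by
  unfold sec
  have hv := volume_Cube_ne_zero a hh
  split_ifs with hp1
  · intro h0
    rw [ENNReal.rpow_eq_zero_iff_of_pos hq, ENNReal.essSup_eq_zero_iff] at h0
    have : ∀ᵐ x ∂(volume.restrict (Cube a h)), False := by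
      filter_upwards [h0] with x hx
      simp at hx
    rw [Filter.eventually_false_iff_eq_bot, ae_eq_bot, Measure.restrict_eq_zero] at this
    exact hv this
  · have hd := dualExp_pos hp hp1
    intro h0
    rw [ENNReal.rpow_eq_zero_iff_of_pos (by positivity), mul_eq_zero, ENNReal.inv_eq_zero] at h0
    rcases h0 with h0 | h0
    · exact volume_Cube_ne_top _ _ h0
    · refine setlint_ne_zero (hw.ennreal_ofReal.pow_const _) hv (Filter.Eventually.of_forall fun x => ?_) h0
      rw [ENNReal.rpow_neg]
      simp [hd.le]

theorem of_sec_ne_top {n : ℕ} {p q : ℝ} (hp : 1 ≤ p) (hq : 0 < q) {w : Euc n → ℝ} (hw : Measurable w)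
    (a : Euc n) {h : ℝ} (hs : sec p q w a h ≠ ⊤) :
    (∀ᵐ x ∂(volume.restrict (Cube a h)), ENNReal.ofReal (w x) ≠ 0) ∧
    (p ≠ 1 → ∫⁻ x in Cube a h, ENNReal.ofReal (w x) ^ (-(dualExp p)) ≠ ⊤) := by
  unfold sec at hs
  split_ifs at hs with hp1
  · refine ⟨?_, fun h => absurd hp1 h⟩
    have h1 : essSup (fun x => (ENNReal.ofReal (w x))⁻¹) (volume.restrict (Cube a h)) ≠ ⊤ := by
      intro h2; rw [h2, ENNReal.top_rpow_of_pos hq] at hs; exact hs rfl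
    filter_upwards [ENNReal.ae_le_essSup (fun x => (ENNReal.ofReal (w x))⁻¹)] with x hx h0
    rw [h0, ENNReal.inv_zero] at hx
    exact h1 (top_le_iff.1 hx)
  · have hd := dualExp_pos hp hp1
    have h1 : ∫⁻ x in Cube a h, ENNReal.ofReal (w x) ^ (-(dualExp p)) ≠ ⊤ := by
      intro h2
      rw [h2, ENNReal.mul_top (ENNReal.inv_ne_zero.2 (volume_Cube_ne_top _ _)), ENNReal.top_rpow_of_pos (by positivity)] at hs
      exact hs rfl
    refine ⟨?_, fun _ => h1⟩
    filter_upwards [ae_lt_top (hw.ennreal_ofReal.pow_const _) h1] with x hx h0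
    rw [h0, ENNReal.zero_rpow_of_neg (by linarith)] at hx
    exact lt_irrefl _ hx

theorem sec_ne_top_of {n : ℕ} {p q : ℝ} (hp : 1 ≤ p) (hq : 0 < q) {w : Euc n → ℝ} (hw : Measurable w)
    (hA : Apq p q w < ⊤) (a : Euc n) {h : ℝ} (hh : 0 < h)
    (hI : ∫⁻ x in Cube a h, ENNReal.ofReal (w x) ^ q ≠ 0) : sec p q w a h ≠ ⊤ := by
  intro ht
  have := le_Apq p q w a hh
  rw [ht, ENNReal.mul_top] at this
  · exact absurd (this.trans_lt hA) (lt_irrefl _)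
  · exact mul_ne_zero (ENNReal.inv_ne_zero.2 (volume_Cube_ne_top _ _)) hI

theorem nondeg {n : ℕ} {p q : ℝ} (hp : 1 ≤ p) (hq : 0 < q) {w : Euc n → ℝ} (hw : Measurable w)
    (hA : Apq p q w < ⊤) (hnz : ¬ ∀ᵐ x, ENNReal.ofReal (w x) = 0) :
    (∀ᵐ x, ENNReal.ofReal (w x) ≠ 0) ∧ ∀ (a : Euc n) (h : ℝ), 0 < h →
      (∫⁻ x in Cube a h, ENNReal.ofReal (w x) ^ q ≠ ⊤) ∧
      (p ≠ 1 → ∫⁻ x in Cube a h, ENNReal.ofReal (w x) ^ (-(dualExp p)) ≠ ⊤) := by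
  have hu : Measurable (fun x => ENNReal.ofReal (w x) ^ q) := hw.ennreal_ofReal.pow_const _
  let Q : ℕ → Set (Euc n) := fun m => Cube (ctr 0 (m+1)) (2*(m+1))
  have hQm : ∀ m m', m ≤ m' → Q m ⊆ Q m' := by
    intro m m' h x hx i
    have h' : (m:ℝ) ≤ m' := by exact_mod_cast h
    have := hx i
    simp only [ctr, PiLp.zero_apply] at this ⊢
    constructor <;> linarith [this.1, this.2]
  have hQU : ∀ P : Euc n → Prop, (∀ m, ∀ᵐ x ∂(volume.restrict (Q m)), P x) → ∀ᵐ x, P x := by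
    intro P hP
    have : ∀ᵐ x, ∀ m, x ∈ Q m → P x := by
      rw [ae_all_iff]; intro m
      exact (ae_restrict_iff' (measurableSet_Cube _ _)).1 (hP m)
    filter_upwards [this] with x hx
    obtain ⟨m, hm⟩ := exists_nat_ge ‖x‖
    refine hx m (ball_sub_Cube _ _ ?_)
    simp; linarith
  have h1 : ∃ m, ∫⁻ x in Q m, ENNReal.ofReal (w x) ^ q ≠ 0 := by
    by_contra hcon
    push Not at hcon
    apply hnz
    apply hQU
    intro m
    have := hcon m
    rw [lintegral_eq_zero_iff hu] at this
    filter_upwards [this] with x hx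
    exact (ENNReal.rpow_eq_zero_iff_of_pos hq).1 hx
  obtain ⟨m1, hm1⟩ := h1
  have hpos : ∀ᵐ x, ENNReal.ofReal (w x) ≠ 0 := by
    apply hQU
    intro m
    have hI : ∫⁻ x in Q (m + m1), ENNReal.ofReal (w x) ^ q ≠ 0 := fun h0 =>
      hm1 (le_antisymm ((lintegral_mono_set (hQm m1 (m+m1) (by omega))).trans h0.le) zero_le)
    have h2 := (of_sec_ne_top hp hq hw _ (sec_ne_top_of hp hq hw hA _ (by positivity) hI)).1
    exact ae_restrict_of_ae_restrict_of_subset (hQm m (m+m1) (by omega)) h2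
  refine ⟨hpos, fun a h hh => ?_⟩
  have hI : ∫⁻ x in Cube a h, ENNReal.ofReal (w x) ^ q ≠ 0 := by
    refine setlint_ne_zero hu (volume_Cube_ne_zero a hh) ?_
    filter_upwards [hpos] with x hx h0
    exact hx ((ENNReal.rpow_eq_zero_iff_of_pos hq).1 h0)
  refine ⟨fun ht => ?_, (of_sec_ne_top hp hq hw _ (sec_ne_top_of hp hq hw hA _ hh hI)).2⟩
  have := le_Apq p q w a hh
  rw [ht, ENNReal.mul_top (ENNReal.inv_ne_zero.2 (volume_Cube_ne_top _ _)), ENNReal.top_mul (sec_ne_zero hp hq hw a hh)] at this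
  exact absurd (this.trans_lt hA) (lt_irrefl _)

end Part6

section Part7
open MeasureTheory ENNReal Set

theorem dimC_ne_zero (n : ℕ) : dimC n ≠ 0 :=
  mul_ne_zero (by simp) (ENNReal.inv_ne_zero.2 measure_ball_lt_top.ne)

theorem int_supp {n : ℕ} {u : Euc n → ℝ≥0∞} (h : ∀ (a : Euc n) (h : ℝ), 0 < h → ∫⁻ x in Cube a h, u x ≠ ⊤)
    {f : Euc n → ℝ} (hc : HasCompactSupport f) : ∫⁻ x in tsupport f, u x ≠ ⊤ := by
  obtain ⟨R, hR⟩ := hc.isCompact.isBounded.subset_closedBall 0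
  have hs : tsupport f ⊆ Cube (ctr 0 (max R 1)) (2 * (max R 1)) :=
    (hR.trans (Metric.closedBall_subset_closedBall (le_max_left _ _))).trans (ball_sub_Cube _ _)
  exact ne_top_of_le_ne_top (h _ _ (by positivity)) (lintegral_mono_set hs)

theorem a1_bound {n : ℕ} {q : ℝ} (hq : 0 < q) {w : Euc n → ℝ}
    (hpos : ∀ᵐ x, ENNReal.ofReal (w x) ≠ 0) :
    ∀ᵐ y, cMax volume (fun x => ENNReal.ofReal (w x) ^ q) y ≤
      dimC n * Apq 1 q w * ENNReal.ofReal (w y) ^ q := by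
  let z : ℕ → Euc n := TopologicalSpace.denseSeq (Euc n)
  let a : ℕ → ℤ → Euc n := fun i k => ctr (z i) (3 * 2^k)
  have hess : ∀ᵐ y, ∀ i : ℕ, ∀ k : ℤ, y ∈ Cube (a i k) (2 * (3 * 2^k)) →
      (ENNReal.ofReal (w y))⁻¹ ≤ essSup (fun x => (ENNReal.ofReal (w x))⁻¹)
        (volume.restrict (Cube (a i k) (2 * (3 * 2^k)))) := by
    rw [ae_all_iff]; intro i
    rw [ae_all_iff]; intro k
    exact (ae_restrict_iff' (measurableSet_Cube _ _)).1
      (ENNReal.ae_le_essSup (fun x => (ENNReal.ofReal (w x))⁻¹))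
  filter_upwards [hess, hpos] with y hy hy0
  refine iSup_le fun k => ?_
  have hr : (0:ℝ) < 2^k := by positivity
  obtain ⟨i, hi⟩ := (TopologicalSpace.denseRange_denseSeq (Euc n)).exists_dist_lt y hr
  have hsub : Metric.closedBall y (2^k) ⊆ Cube (a i k) (2 * (3 * 2^k)) := by
    refine (Metric.closedBall_subset_closedBall' ?_).trans (ball_sub_Cube (z i) (3 * 2^k))
    have : dist y (z i) < 2^k := hi
    linarith
  have hyQ := hsub (Metric.mem_closedBall_self hr.le)
  have h1 := hy i k hyQ
  have h2 := le_Apq 1 q w (a i k) (h := 2 * (3 * 2^k)) (by positivity)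
  have hV := volume_Cube6 (a i k) y hr
  set B := volume (Metric.closedBall y ((2:ℝ)^k))
  set V := volume (Cube (a i k) (2 * (3 * 2^k)))
  set I := ∫⁻ x in Cube (a i k) (2 * (3 * 2^k)), ENNReal.ofReal (w x) ^ q
  rw [sec, if_pos rfl] at h2
  have h3 : V⁻¹ * I * (ENNReal.ofReal (w y) ^ q)⁻¹ ≤ Apq 1 q w := by
    refine le_trans (mul_le_mul_right ?_ _) h2
    rw [← ENNReal.inv_rpow]
    exact ENNReal.rpow_le_rpow h1 hq.le
  have hu0 : ENNReal.ofReal (w y) ^ q ≠ 0 := fun h => hy0 ((ENNReal.rpow_eq_zero_iff_of_pos hq).1 h)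
  have hut : ENNReal.ofReal (w y) ^ q ≠ ⊤ := ENNReal.rpow_ne_top_of_nonneg hq.le ENNReal.ofReal_ne_top
  rw [← div_eq_mul_inv, ENNReal.div_le_iff hu0 hut] at h3
  have hB : B⁻¹ = dimC n * V⁻¹ := by
    rw [hV, ENNReal.mul_inv (Or.inl (dimC_ne_zero n)) (Or.inl (dimC_ne_top n)), ← mul_assoc,
      ENNReal.mul_inv_cancel (dimC_ne_zero n) (dimC_ne_top n), one_mul]
  calc _ ≤ I * B⁻¹ := by
        rw [div_eq_mul_inv]
        exact mul_le_mul_left (lintegral_mono_set hsub) _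
    _ = dimC n * (V⁻¹ * I) := by rw [hB]; ring
    _ ≤ _ := by rw [mul_assoc]; exact mul_le_mul_right h3 _

theorem case_one {n : ℕ} (hn : 2 ≤ n) (q : ℝ) (hq : q = 1/(1 - 1/(n:ℝ))) :
    ∃ C : ℝ≥0∞, C ≠ ⊤ ∧ ∀ w : Euc n → ℝ, Measurable w → Apq 1 q w < ⊤ →
      (∀ᵐ x, ENNReal.ofReal (w x) ≠ 0) →
      (∀ (a : Euc n) (h : ℝ), 0 < h → ∫⁻ x in Cube a h, ENNReal.ofReal (w x) ^ q ≠ ⊤) →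
      ∀ (f : Euc n → ℝ) (K : NNReal), LipschitzWith K f → HasCompactSupport f →
      (∫⁻ x, (ENNReal.ofReal |f x| * ENNReal.ofReal (w x)) ^ q) ^ (1 / q) ≤
        C * Apq 1 q w ^ (1 - 1 / (n : ℝ)) *
          ∫⁻ x, ENNReal.ofReal ‖fderiv ℝ f x‖ * ENNReal.ofReal (w x) := by
  have hn' : (2:ℝ) ≤ n := by exact_mod_cast hn
  have hinv : 1/(n:ℝ) < 1 := by rw [div_lt_one (by linarith)]; linarith
  obtain ⟨C, hC, hCb⟩ := strong_sobolev hn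
  set θ : ℝ := 1 - 1/(n:ℝ) with hθ
  have hθ0 : 0 < θ := by linarith
  have hq0 : 0 < q := by rw [hq]; positivity
  refine ⟨C * dimC n ^ θ, ENNReal.mul_ne_top hC (ENNReal.rpow_ne_top_of_nonneg hθ0.le (dimC_ne_top n)),
    fun w hw hA hpos hfin f K hf hc => ?_⟩
  have hu : Measurable (fun x => ENNReal.ofReal (w x) ^ q) := hw.ennreal_ofReal.pow_const _
  have hG : Measurable fun y => ENNReal.ofReal ‖fderiv ℝ f y‖ := (measurable_fderiv ℝ f).norm.ennreal_ofReal
  have main := hCb _ hu f K hf hc (int_supp hfin hc)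
  have hqθ : 1/q = θ := by rw [hq]; simp
  rw [← hq] at main
  rw [hqθ]
  simp_rw [ENNReal.mul_rpow_of_nonneg _ _ hq0.le]
  refine main.trans ?_
  calc _ ≤ C * ∫⁻ y, (dimC n ^ θ * Apq 1 q w ^ θ) * (ENNReal.ofReal ‖fderiv ℝ f y‖ * ENNReal.ofReal (w y)) := by
        refine mul_le_mul_right (lintegral_mono_ae ?_) _
        filter_upwards [a1_bound hq0 hpos] with y hy
        calc _ ≤ ENNReal.ofReal ‖fderiv ℝ f y‖ * (dimC n * Apq 1 q w * ENNReal.ofReal (w y) ^ q)^θ :=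
              mul_le_mul_right (ENNReal.rpow_le_rpow hy hθ0.le) _
          _ = _ := by
            rw [ENNReal.mul_rpow_of_nonneg _ _ hθ0.le, ENNReal.mul_rpow_of_nonneg _ _ hθ0.le,
              ← ENNReal.rpow_mul, show q * θ = 1 by rw [← hqθ]; field_simp, ENNReal.rpow_one]
            ring
    _ = _ := by
        rw [lintegral_const_mul _ (by exact hG.mul hw.ennreal_ofReal)]
        ring

theorem ball_cond {n : ℕ} {p q : ℝ} (hp : 1 < p) (hq : 0 < q) {w : Euc n → ℝ} (hA : Apq p q w < ⊤)
    {s : ℝ} (hs : s - 1 = dualExp p / q) (hs1 : 1 < s) (x : Euc n) {r : ℝ} (hr : 0 < r) :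
    (∫⁻ y in Metric.closedBall x (3*r), ENNReal.ofReal (w y)^q)^(s-1) *
      (∫⁻ y in Metric.closedBall x (3*r), ENNReal.ofReal (w y)^(-(dualExp p))) ≤
      (Apq p q w ^ (s-1) * dimC n ^ s) * volume (Metric.closedBall x r)^s := by
  have hd := dualExp_pos hp.le hp.ne'
  have h2 := le_Apq p q w (ctr x (3*r)) (h := 2 * (3 * r)) (by positivity)
  have hsub := ball_sub_Cube x (3*r)
  have hV := volume_Cube6 (ctr x (3*r)) x hr
  have hV0 := volume_Cube_ne_zero (ctr x (3*r)) (h := 2*(3*r)) (by positivity)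
  have hVt := volume_Cube_ne_top (ctr x (3*r)) (2*(3*r))
  rw [sec, if_neg hp.ne'] at h2
  have hI := lintegral_mono_set (μ := volume) (f := fun y => ENNReal.ofReal (w y)^q) hsub
  have hJ := lintegral_mono_set (μ := volume) (f := fun y => ENNReal.ofReal (w y)^(-(dualExp p))) hsub
  set V := volume (Cube (ctr x (3*r)) (2 * (3 * r)))
  set I := ∫⁻ y in Cube (ctr x (3*r)) (2 * (3 * r)), ENNReal.ofReal (w y) ^ q
  set J := ∫⁻ y in Cube (ctr x (3*r)) (2 * (3 * r)), ENNReal.ofReal (w y)^(-(dualExp p))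
  have hs0 : 0 ≤ s - 1 := by linarith
  have h3 := ENNReal.rpow_le_rpow h2 hs0
  rw [ENNReal.mul_rpow_of_nonneg _ _ hs0, ← ENNReal.rpow_mul, show q / dualExp p * (s-1) = 1 by rw [hs]; field_simp,
    ENNReal.rpow_one] at h3
  have hVs : V^s = V^(s-1) * V := by
    nth_rewrite 3 [← ENNReal.rpow_one V]
    rw [← ENNReal.rpow_add _ _ hV0 hVt]; congr 1; ring
  calc _ ≤ I^(s-1) * J := mul_le_mul' (ENNReal.rpow_le_rpow hI hs0) hJ
    _ = (V⁻¹ * V)^(s-1) * (V⁻¹ * V) * (I^(s-1) * J) := by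
        rw [ENNReal.inv_mul_cancel hV0 hVt]; simp
    _ = ((V⁻¹ * I)^(s-1) * (V⁻¹ * J)) * V^s := by
        rw [hVs, ENNReal.mul_rpow_of_nonneg _ _ hs0, ENNReal.mul_rpow_of_nonneg _ _ hs0]; ring
    _ ≤ Apq p q w ^ (s-1) * V^s := mul_le_mul_left h3 _
    _ = _ := by rw [hV, ENNReal.mul_rpow_of_nonneg _ _ (by linarith)]; ring

theorem case_gt {n : ℕ} (hn : 2 ≤ n) (p q : ℝ) (hp : 1 < p) (hq0 : 0 < q)
    (hq : 1 / p - 1 / q = 1 / (n : ℝ)) :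
    ∃ C : ℝ≥0∞, C ≠ ⊤ ∧ ∀ w : Euc n → ℝ, Measurable w → Apq p q w < ⊤ →
      (∀ᵐ x, ENNReal.ofReal (w x) ≠ 0) →
      (∀ (a : Euc n) (h : ℝ), 0 < h → ∫⁻ x in Cube a h, ENNReal.ofReal (w x) ^ q ≠ ⊤) →
      (∀ (a : Euc n) (h : ℝ), 0 < h → ∫⁻ x in Cube a h, ENNReal.ofReal (w x) ^ (-(dualExp p)) ≠ ⊤) →
      ∀ (f : Euc n → ℝ) (K : NNReal), LipschitzWith K f → HasCompactSupport f →
      (∫⁻ x, (ENNReal.ofReal |f x| * ENNReal.ofReal (w x)) ^ q) ^ (1 / q) ≤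
        C * Apq p q w ^ (1 - 1 / (n : ℝ)) *
          (∫⁻ x, (ENNReal.ofReal ‖fderiv ℝ f x‖ * ENNReal.ofReal (w x)) ^ p) ^ (1/p) := by
  have hn' : (2:ℝ) ≤ n := by exact_mod_cast hn
  have hinv : 1/(n:ℝ) < 1 := by rw [div_lt_one (by linarith)]; linarith
  obtain ⟨C, hC, hCb⟩ := strong_sobolev hn
  set θ : ℝ := 1 - 1/(n:ℝ) with hθ
  have hθ0 : 0 < θ := by linarith
  have hd := dualExp_pos hp.le hp.ne'
  have hd1 : 1 / dualExp p = 1 - 1/p := by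
    unfold dualExp; have : p - 1 ≠ 0 := by linarith
    field_simp
  have hconj : p.HolderConjugate (dualExp p) := Real.HolderConjugate.conjExponent hp
  have hball := fun (w : Euc n → ℝ) (hA : Apq p q w < ⊤) (s : ℝ) hs hs1 (x : Euc n) (r : ℝ) (hr : 0 < r) =>
    ball_cond hp hq0 hA (s := s) hs hs1 x hr
  set d := dualExp p
  have hθq : θ = 1/q + 1/d := by rw [hd1, hθ]; linarith
  set s : ℝ := d * θ with hsdef
  have hs' : s - 1 = d / q := by rw [hsdef, hθq]; field_simp; ring
  have hs1 : 1 < s := by have : 0 < d/q := by positivity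
                         linarith
  have hs0 : 0 < s := by linarith
  obtain ⟨C2, hC2, hB⟩ := buckley n hs1
  set E : ℝ≥0∞ := dimC n ^ s with hE
  have hEt : E ≠ ⊤ := ENNReal.rpow_ne_top_of_nonneg hs0.le (dimC_ne_top n)
  have hss : 0 ≤ s/(s-1) := by apply div_nonneg <;> linarith
  refine ⟨C * (C2 * E^(s/(s-1)))^(1/d), ENNReal.mul_ne_top hC (ENNReal.rpow_ne_top_of_nonneg (by positivity)
    (ENNReal.mul_ne_top hC2 (ENNReal.rpow_ne_top_of_nonneg hss hEt))),
    fun w hw hA hpos hfin hfin2 f K hf hc => ?_⟩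
  have hW := hw.ennreal_ofReal
  have hu : Measurable (fun x => ENNReal.ofReal (w x) ^ q) := hW.pow_const _
  have hσ : Measurable (fun x => ENNReal.ofReal (w x) ^ (-d)) := hW.pow_const _
  have hG : Measurable fun y => ENNReal.ofReal ‖fderiv ℝ f y‖ := (measurable_fderiv ℝ f).norm.ennreal_ofReal
  have hfm : Measurable (fun x => ENNReal.ofReal |f x|) := hf.continuous.measurable.abs.ennreal_ofReal
  have hqθ : 0 < q - 1/θ := by
    have : 1 < q * θ := by
      rw [hθq]
      have : 0 < q/d := by positivity
      have e : q * (1/q+1/d) = 1 + q/d := by field_simp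
      linarith
    have : 1/θ < q := by rw [div_lt_iff₀ hθ0]; exact this
    linarith
  let h : Euc n → ℝ≥0∞ := fun x => ENNReal.ofReal |f x| ^ (q - 1/θ)
  have hh : Measurable h := hfm.pow_const _
  obtain ⟨M, hM⟩ := hc.exists_bound_of_continuous hf.continuous
  have hM' : ∀ x, ENNReal.ofReal |f x| ≤ ENNReal.ofReal M := fun x => ENNReal.ofReal_le_ofReal (hM x)
  have hUfin := int_supp hfin hc
  have bdd : ∀ r : ℝ, 0 < r → ∫⁻ x in tsupport f, ENNReal.ofReal |f x|^r * ENNReal.ofReal (w x)^q ≠ ⊤ := by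
    intro r hr
    refine ne_top_of_le_ne_top (b := ENNReal.ofReal M ^ r * ∫⁻ x in tsupport f, ENNReal.ofReal (w x)^q) ?_ ?_
    · exact ENNReal.mul_ne_top (ENNReal.rpow_ne_top_of_nonneg hr.le ENNReal.ofReal_ne_top) hUfin
    · rw [← lintegral_const_mul _ hu]
      exact lintegral_mono fun x => mul_le_mul_left (ENNReal.rpow_le_rpow (hM' x) hr.le) _
  set X := ∫⁻ x, ENNReal.ofReal |f x| ^ q * ENNReal.ofReal (w x)^q with hX
  have hXt : X ≠ ⊤ := by
    have : X = ∫⁻ x in tsupport f, ENNReal.ofReal |f x|^q * ENNReal.ofReal (w x)^q := by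
      refine (setLIntegral_eq_of_support_subset ?_).symm
      intro x hx
      refine subset_tsupport f fun hfx => hx ?_
      simp [hfx, hq0]
    rw [this]; exact bdd q hq0
  simp_rw [ENNReal.mul_rpow_of_nonneg _ _ hq0.le]
  rw [← hX]
  rcases eq_or_ne X 0 with hX0 | hX0
  · rw [hX0, ENNReal.zero_rpow_of_pos (by positivity)]; exact zero_le
  have main := hCb (fun x => h x * ENNReal.ofReal (w x)^q) (hh.mul hu) f K hf hc (bdd _ hqθ)
  have e1 : ∀ x, ENNReal.ofReal |f x| ^ (1/θ) * (h x * ENNReal.ofReal (w x)^q) =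
      ENNReal.ofReal |f x| ^ q * ENNReal.ofReal (w x)^q := by
    intro x
    rw [← mul_assoc, ← ENNReal.rpow_add_of_nonneg _ _ (by positivity) hqθ.le]
    congr 2; ring
  simp_rw [e1] at main
  rw [← hX] at main
  set A := Apq p q w
  -- the maximal function estimate
  have hmax := hB (fun x => ENNReal.ofReal (w x) ^ q) (fun x => ENNReal.ofReal (w x) ^ (-d)) h hu hσ hh
    (by
      filter_upwards [hpos] with x hx
      refine ⟨?_, ?_, ?_⟩
      · rw [ENNReal.rpow_neg]; exact ENNReal.inv_ne_zero.2 (ENNReal.rpow_ne_top_of_nonneg hd.le ENNReal.ofReal_ne_top)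
      · rw [ENNReal.rpow_neg]; exact ENNReal.inv_ne_top.2 fun h0 => hx ((ENNReal.rpow_eq_zero_iff_of_pos hd).1 h0)
      · rw [← ENNReal.rpow_mul, hs']; congr 1; field_simp)
    (A^(s-1) * E)
    (by
      intro x r hr
      have hB0 : volume (Metric.closedBall x r) ≠ 0 := (Metric.measure_closedBall_pos _ _ hr).ne'
      have msb : ∀ r : ℝ, MeasurableSet (Metric.closedBall x r) := fun r => Metric.isClosed_closedBall.measurableSet
      simp only [withDensity_apply _ (msb _)]
      refine ⟨?_, ?_, ?_, ?_, hball w hA s hs' hs1 x r hr⟩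
      · refine setlint_ne_zero hu hB0 ?_
        filter_upwards [hpos] with y hy h0
        exact hy ((ENNReal.rpow_eq_zero_iff_of_pos hq0).1 h0)
      · exact ne_top_of_le_ne_top (hfin _ _ (by positivity)) (lintegral_mono_set (ball_sub_Cube x r))
      · refine setlint_ne_zero hσ hB0 (Filter.Eventually.of_forall fun y => ?_)
        rw [ENNReal.rpow_neg]; exact ENNReal.inv_ne_zero.2 (ENNReal.rpow_ne_top_of_nonneg hd.le ENNReal.ofReal_ne_top)
      · exact ne_top_of_le_ne_top (hfin2 _ _ (by positivity)) (lintegral_mono_set (ball_sub_Cube x r)))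
  have e2 : ∀ x, h x ^ s * ENNReal.ofReal (w x)^q = ENNReal.ofReal |f x| ^ q * ENNReal.ofReal (w x)^q := by
    intro x
    simp only [h]
    rw [← ENNReal.rpow_mul]
    congr 2
    have : s = d * θ := rfl
    rw [this, hθq]; field_simp; ring
  simp_rw [e2] at hmax
  rw [← hX] at hmax
  set Mx : Euc n → ℝ≥0∞ := cMax volume (fun x => h x * ENNReal.ofReal (w x)^q) with hMx
  have hMm : Measurable Mx := measurable_cMax volume (hh.mul hu)
  set N := (∫⁻ x, (ENNReal.ofReal ‖fderiv ℝ f x‖ * ENNReal.ofReal (w x)) ^ p) ^ (1/p) with hN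
  have hold : ∫⁻ y, ENNReal.ofReal ‖fderiv ℝ f y‖ * Mx y ^ θ ≤ N * (∫⁻ y, Mx y ^ s * ENNReal.ofReal (w y) ^ (-d))^(1/d) := by
    have e3 : ∫⁻ y, ENNReal.ofReal ‖fderiv ℝ f y‖ * Mx y ^ θ =
        ∫⁻ y, ((fun y => ENNReal.ofReal ‖fderiv ℝ f y‖ * ENNReal.ofReal (w y)) *
          (fun y => Mx y ^ θ * (ENNReal.ofReal (w y))⁻¹)) y := by
      refine lintegral_congr_ae ?_
      filter_upwards [hpos] with y hy
      simp only [Pi.mul_apply]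
      calc _ = ENNReal.ofReal ‖fderiv ℝ f y‖ * Mx y ^ θ * (ENNReal.ofReal (w y) * (ENNReal.ofReal (w y))⁻¹) := by
            rw [ENNReal.mul_inv_cancel hy ENNReal.ofReal_ne_top, mul_one]
        _ = _ := by ring
    rw [e3]
    refine (ENNReal.lintegral_mul_le_Lp_mul_Lq volume hconj (hG.mul hW).aemeasurable
      ((hMm.pow_const _).mul hW.inv).aemeasurable).trans_eq ?_
    rw [hN]
    congr 2
    refine lintegral_congr fun y => ?_
    simp only [Pi.mul_apply, Pi.inv_apply]
    rw [ENNReal.mul_rpow_of_nonneg _ _ hd.le, ← ENNReal.rpow_mul, mul_comm θ d, ENNReal.inv_rpow, ENNReal.rpow_neg]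
  have hA2 : (A^(s-1) * E)^(s/(s-1)) = A^s * E^(s/(s-1)) := by
    rw [ENNReal.mul_rpow_of_nonneg _ _ hss, ← ENNReal.rpow_mul]
    congr 2
    have : s - 1 ≠ 0 := by linarith
    field_simp
  have hd0 : 0 ≤ 1/d := by positivity
  have fin : X^θ ≤ (C * (C2 * E^(s/(s-1)))^(1/d) * A^θ * N) * X^(1/d) := by
    calc X^θ ≤ C * (N * (C2 * (A^(s-1) * E)^(s/(s-1)) * X)^(1/d)) :=
          main.trans (mul_le_mul_right (hold.trans (mul_le_mul_right (ENNReal.rpow_le_rpow hmax hd0) _)) _)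
      _ = C * (N * ((C2 * E^(s/(s-1)))^(1/d) * (A^s)^(1/d) * X^(1/d))) := by
          rw [hA2, ← ENNReal.mul_rpow_of_nonneg _ _ hd0, ← ENNReal.mul_rpow_of_nonneg _ _ hd0]
          congr 3; ring
      _ = _ := by
          rw [← ENNReal.rpow_mul A, show s * (1/d) = θ by rw [hsdef]; field_simp]; ring
  rw [hθq, ENNReal.rpow_add _ _ hX0 hXt, ← hθq] at fin
  have hXd0 : X^(1/d) ≠ 0 := fun h0 => hX0 ((ENNReal.rpow_eq_zero_iff_of_pos (by positivity)).1 h0)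
  have hXdt : X^(1/d) ≠ ⊤ := ENNReal.rpow_ne_top_of_nonneg hd0 hXt
  exact (ENNReal.mul_le_mul_iff_left hXd0 hXdt).1 fin


end Part7

/-- Sharp weighted Sobolev inequality (Theorem 2.7). -/
theorem weighted_sobolev_sharp
    (n : ℕ) (hn : 2 ≤ n) (p q : ℝ) (hp : 1 ≤ p) (hpn : p < n)
    (hq : 1 / p - 1 / q = 1 / (n : ℝ)) :
    ∃ c : ℝ, 0 < c ∧ ∀ w : Euc n → ℝ, Measurable w → (∀ x, 0 ≤ w x) → Apq p q w < ⊤ →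
      ∀ (f : Euc n → ℝ) (K : NNReal), LipschitzWith K f → HasCompactSupport f →
      (∫⁻ x, (ENNReal.ofReal |f x| * ENNReal.ofReal (w x)) ^ q) ^ (1 / q) ≤
        ENNReal.ofReal c * Apq p q w ^ (1 - 1 / (n : ℝ)) *
          (∫⁻ x, (ENNReal.ofReal ‖fderiv ℝ f x‖ * ENNReal.ofReal (w x)) ^ p) ^ (1 / p) := by
  have hq0 : 0 < q := by
    have h1 : 1/(n:ℝ) < 1/p := one_div_lt_one_div_of_lt (by linarith) hpn
    have h2 : 0 < 1/q := by linarith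
    exact one_div_pos.1 h2
  have hC : ∃ C : ℝ≥0∞, C ≠ ⊤ ∧ ∀ w : Euc n → ℝ, Measurable w → Apq p q w < ⊤ →
      (¬ ∀ᵐ x, ENNReal.ofReal (w x) = 0) →
      ∀ (f : Euc n → ℝ) (K : NNReal), LipschitzWith K f → HasCompactSupport f →
      (∫⁻ x, (ENNReal.ofReal |f x| * ENNReal.ofReal (w x)) ^ q) ^ (1 / q) ≤
        C * Apq p q w ^ (1 - 1 / (n : ℝ)) *
          (∫⁻ x, (ENNReal.ofReal ‖fderiv ℝ f x‖ * ENNReal.ofReal (w x)) ^ p) ^ (1 / p) := by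
    rcases eq_or_lt_of_le hp with h1 | h1
    · subst h1
      have hqe : q = 1/(1 - 1/(n:ℝ)) := by
        rw [show 1 - 1/(n:ℝ) = 1/q by linarith]; simp
      obtain ⟨C, hC, hb⟩ := case_one hn q hqe
      refine ⟨C, hC, fun w hw hA hnz f K hf hc => ?_⟩
      obtain ⟨hpos, hfin⟩ := nondeg hp hq0 hw hA hnz
      have := hb w hw hA hpos (fun a h hh => (hfin a h hh).1) f K hf hc
      simpa using this
    · obtain ⟨C, hC, hb⟩ := case_gt hn p q h1 hq0 hq
      refine ⟨C, hC, fun w hw hA hnz f K hf hc => ?_⟩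
      obtain ⟨hpos, hfin⟩ := nondeg hp hq0 hw hA hnz
      exact hb w hw hA hpos (fun a h hh => (hfin a h hh).1) (fun a h hh => (hfin a h hh).2 h1.ne') f K hf hc
  obtain ⟨C, hC, hb⟩ := hC
  refine ⟨C.toReal + 1, by positivity, fun w hw _ hA f K hf hc => ?_⟩
  by_cases hnz : ∀ᵐ x, ENNReal.ofReal (w x) = 0
  · have : ∫⁻ x, (ENNReal.ofReal |f x| * ENNReal.ofReal (w x)) ^ q = 0 := by
      rw [← lintegral_zero (μ := (volume : Measure (Euc n)))]
      refine lintegral_congr_ae ?_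
      filter_upwards [hnz] with x hx
      rw [hx, mul_zero, ENNReal.zero_rpow_of_pos hq0]
    rw [this, ENNReal.zero_rpow_of_pos (by positivity)]
    exact zero_le
  · refine (hb w hw hA hnz f K hf hc).trans ?_
    have hCle : C ≤ ENNReal.ofReal (C.toReal + 1) := by
      rw [← ENNReal.ofReal_toReal hC]
      refine ENNReal.ofReal_le_ofReal ?_
      simp [ENNReal.toReal_nonneg]
    exact mul_le_mul_left (mul_le_mul_left hCle _) _

end
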